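/- Let n ≥ 5 and t = 2k with k ≥ 0 and n ≥ 2t + 1. For every cactus G with n vertices and exactly t cycles, W_e(G) ≤ (1/6)n³ − (1/2)n² + (1/3)n + k·n² − 4k²·n + (4/3)k³ + 8k² − (10/3)k, with equality if and only if G is isomorphic to the saw graph Sw(k, k; n − 4k − 1). -/

import Mathlib

open SimpleGraph Finset
open scoped Classical

/-- The distance `d_G(f,g)` between two edges: `0` if they coincide, otherwise the minimum
distance between endpoints plus one (i.e. the distance in the line graph). -/
noncomputable def eDist {V : Type*} (G : SimpleGraph V) (e f : Sym2 V) : ℕ :=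
  if e = f then 0 else sInf {n : ℕ | ∃ u ∈ e, ∃ w ∈ f, G.dist u w = n} + 1

/-- The distance `d_G(v,f)` between a vertex and an edge: the minimum distance to an endpoint. -/
noncomputable def vDist {V : Type*} (G : SimpleGraph V) (v : V) (e : Sym2 V) : ℕ :=
  sInf {n : ℕ | ∃ u ∈ e, G.dist v u = n}

/-- The edge-Wiener index `W_e(G)`: the sum of `eDist` over unordered pairs of edges. -/
noncomputable def edgeWiener {V : Type*} [Fintype V] (G : SimpleGraph V) : ℕ :=
  (∑ e ∈ G.edgeFinset, ∑ f ∈ G.edgeFinset, eDist G e f) / 2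

/-- A cactus: a connected simple graph in which any two distinct cycles (distinguished by
their edge sets) share at most one vertex. -/
def IsCactus {V : Type*} (G : SimpleGraph V) : Prop :=
  G.Connected ∧ ∀ (u w : V) (c1 : G.Walk u u) (c2 : G.Walk w w),
    c1.IsCycle → c2.IsCycle → c1.edges.toFinset ≠ c2.edges.toFinset →
      (c1.support.toFinset ∩ c2.support.toFinset).card ≤ 1

/-- The saw graph `Sw(i, j; q)`: a spine path `s_0 s_1 ⋯ s_{i+q+j}` whose first `i` edges
carry the triangles of a triangle-chain of length `i` (apexes `Sum.inr (Sum.inl k)`),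
whose last `j` edges carry the triangles of a triangle-chain of length `j`
(apexes `Sum.inr (Sum.inr k)`), and whose middle `q` edges form the joining path between
the end `s_i` of the first chain and the end `s_{i+q}` of the second chain. -/
noncomputable def sawGraph (i j q : ℕ) :
    SimpleGraph (Fin (i + q + j + 1) ⊕ (Fin i ⊕ Fin j)) :=
  SimpleGraph.fromRel (fun a b =>
    (∃ x y : Fin (i + q + j + 1), a = Sum.inl x ∧ b = Sum.inl y ∧ (y : ℕ) = (x : ℕ) + 1) ∨
    (∃ (k : Fin i) (x : Fin (i + q + j + 1)),
        a = Sum.inr (Sum.inl k) ∧ b = Sum.inl x ∧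
          ((x : ℕ) = (k : ℕ) ∨ (x : ℕ) = (k : ℕ) + 1)) ∨
    (∃ (k : Fin j) (x : Fin (i + q + j + 1)),
        a = Sum.inr (Sum.inr k) ∧ b = Sum.inl x ∧
          ((x : ℕ) = i + q + (k : ℕ) ∨ (x : ℕ) = i + q + (k : ℕ) + 1)))

/-! ### Words encoding chains (`true` = triangle, `false` = bridge; head = top) -/

def wsize : List Bool → ℤ
  | [] => 0
  | b :: w => (if b then 3 else 1) + wsize w

def wcnt : List Bool → ℤ
  | [] => 0
  | b :: w => (if b then 1 else 0) + wcnt w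

def wval (m : ℤ) : List Bool → ℤ
  | [] => 0
  | b :: w => wval m w +
      (if b then wsize w * (m - 3 - wsize w) + (m - 3) else wsize w * (m - 1 - wsize w))

def wgain (N : ℤ) : List Bool → ℤ
  | [] => 0
  | b :: w => wgain N w + (N - (if b then 3 else 1) - 2 * wsize w)

lemma wsize_nonneg (w : List Bool) : 0 ≤ wsize w := by
  induction w with
  | nil => simp [wsize]
  | cons b w ih => cases b <;> simp [wsize] <;> omega

lemma wcnt_nonneg (w : List Bool) : 0 ≤ wcnt w := by
  induction w with
  | nil => simp [wcnt]
  | cons b w ih => cases b <;> simp [wcnt] <;> omega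

lemma wcnt_le (w : List Bool) : 3 * wcnt w ≤ wsize w := by
  induction w with
  | nil => simp [wcnt, wsize]
  | cons b w ih => cases b <;> simp [wcnt, wsize] <;> omega

lemma wsize_reverseAux (u w : List Bool) :
    wsize (u.reverseAux w) = wsize u + wsize w := by
  induction u generalizing w with
  | nil => simp [wsize]
  | cons b u ih => rw [List.reverseAux, ih]; simp only [wsize]; ring

lemma wcnt_reverseAux (u w : List Bool) :
    wcnt (u.reverseAux w) = wcnt u + wcnt w := by
  induction u generalizing w with
  | nil => simp [wcnt]
  | cons b u ih => rw [List.reverseAux, ih]; simp only [wcnt]; ring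

lemma wval_reverseAux (m : ℤ) (u w : List Bool) :
    wval m (u.reverseAux w) = wval m u + wval m w +
      (m - wsize u - wsize w) * wgain (wsize u + wsize w) u := by
  induction u generalizing w with
  | nil => simp [wval, wgain]
  | cons b u ih =>
    rw [List.reverseAux, ih]
    have e : wsize u + wsize (b :: w) = wsize (b :: u) + wsize w := by
      simp only [wsize]; ring
    rw [e]
    simp only [wval, wgain]
    cases b <;> simp only [wsize, if_true, if_false, Bool.false_eq_true] <;> ring

lemma wgain_ge (N : ℤ) (w : List Bool) (h : 2 * wsize w ≤ N) :
    wsize w * (N - wsize w) ≤ 3 * wgain N w := by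
  induction w with
  | nil => simp [wsize, wgain]
  | cons b w ih =>
    have h0 := wsize_nonneg w
    cases b <;> simp only [wsize, wgain, if_true, if_false, Bool.false_eq_true] at * <;>
      nlinarith [ih (by linarith)]

/-- merging two chains -/
lemma wmerge (m : ℤ) (u w : List Bool) (h : wsize u + wsize w ≤ m) :
    ∃ x : List Bool, wsize x = wsize u + wsize w ∧ wcnt x = wcnt u + wcnt w ∧
      3 * (wval m u + wval m w) + wsize u * wsize w * (m - wsize u - wsize w) ≤ 3 * wval m x := by
  rcases le_total (wsize u) (wsize w) with h1 | h1
  · refine ⟨u.reverseAux w, wsize_reverseAux u w, wcnt_reverseAux u w, ?_⟩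
    rw [wval_reverseAux]
    have := wgain_ge (wsize u + wsize w) u (by linarith)
    nlinarith [mul_le_mul_of_nonneg_left this (show 0 ≤ m - wsize u - wsize w by linarith)]
  · refine ⟨w.reverseAux u, ?_, ?_, ?_⟩
    · rw [wsize_reverseAux]; ring
    · rw [wcnt_reverseAux]; ring
    rw [wval_reverseAux]
    have := wgain_ge (wsize w + wsize u) w (by linarith)
    nlinarith [mul_le_mul_of_nonneg_left this (show 0 ≤ m - wsize w - wsize u by linarith)]

/-- the numeric optimum: partial sums of minimal triangle costs -/
def gmin (m t p : ℤ) : ℤ :=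
  2 * (3 * min p (t - 1 - p)) * (m - 3 - 3 * min p (t - 1 - p)) + 2 * m - 5

def gsum (m t : ℤ) : List Bool → ℤ
  | [] => 0
  | b :: w => gsum m t w + (if b then gmin m t (wcnt w) else 0)

def sixF (m x : ℤ) : ℤ := 3 * (m - 1) * x * (x - 1) - x * (x - 1) * (2 * x - 1)

lemma gmin_le (m t p y : ℤ) (hp : 0 ≤ p) (hy : 3 * p ≤ y) (hq : 3 * (t - 1 - p) ≤ m - 3 - y) :
    gmin m t p ≤ 2 * y * (m - 3 - y) + 2 * m - 5 := by
  unfold gmin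
  rcases le_total p (t - 1 - p) with h | h
  · rw [min_eq_left h]
    nlinarith [mul_nonneg (show 0 ≤ y - 3 * p by linarith)
      (show 0 ≤ m - 3 - y - 3 * p by linarith)]
  · rw [min_eq_right h]
    nlinarith [mul_nonneg (show 0 ≤ y - 3 * (t - 1 - p) by linarith)
      (show 0 ≤ m - 3 - y - 3 * (t - 1 - p) by linarith)]

lemma gmin_eq (m k p y : ℤ) (hp : 0 ≤ p) (hy : 3 * p ≤ y)
    (hq : 3 * (2 * k - 1 - p) ≤ m - 3 - y)
    (he : 2 * y * (m - 3 - y) + 2 * m - 5 ≤ gmin m (2 * k) p) :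
    (p < k → y = 3 * p) ∧ (k ≤ p → m - 3 - y = 3 * (2 * k - 1 - p)) := by
  unfold gmin at he
  constructor
  · intro h
    rw [min_eq_left (by omega)] at he
    have : (y - 3 * p) * (m - 3 - y - 3 * p) ≤ 0 := by nlinarith
    nlinarith [mul_nonneg (show 0 ≤ y - 3 * p by linarith)
      (show 0 ≤ m - 3 - y - 3 * p - 3 by linarith)]
  · intro h
    rw [min_eq_right (by omega)] at he
    have : (y - 3 * (2 * k - 1 - p)) * (m - 3 - y - 3 * (2 * k - 1 - p)) ≤ 0 := by nlinarith
    nlinarith [mul_nonneg (show 0 ≤ y - 3 * (2 * k - 1 - p) - 3 by linarith)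
      (show 0 ≤ m - 3 - y - 3 * (2 * k - 1 - p) by linarith)]

lemma wval_le (m k : ℤ) (w : List Bool) (h : 3 * (2 * k - wcnt w) ≤ m - wsize w) :
    6 * wval m w ≤ sixF m (wsize w) - 6 * gsum m (2 * k) w := by
  induction w with
  | nil => simp [wval, sixF, gsum, wsize]
  | cons b w ih =>
    have h0 := wcnt_nonneg w
    have h1 := wcnt_le w
    cases b
    · simp only [wval, sixF, gsum, wsize, wcnt, if_false, Bool.false_eq_true] at *
      have := ih (by linarith)
      nlinarith
    · simp only [wval, sixF, gsum, wsize, wcnt, if_true] at *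
      have := ih (by linarith)
      have h2 := gmin_le m (2 * k) (wcnt w) (wsize w) h0 h1 (by linarith)
      nlinarith

lemma replicate_of_tight (w : List Bool) (h : wsize w = 3 * wcnt w) :
    w = List.replicate w.length true := by
  induction w with
  | nil => simp
  | cons b w ih =>
    have h1 := wcnt_le w
    cases b
    · simp only [wsize, wcnt, if_false, Bool.false_eq_true] at h; omega
    · simp only [wsize, wcnt, if_true] at h
      have := ih (by omega)
      rw [List.length_cons, List.replicate_succ, ← this]

lemma wcnt_replicate_true (k : ℕ) : wcnt (List.replicate k true) = k := by
  induction k with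
  | zero => simp [wcnt]
  | succ k ih => simp [List.replicate_succ, wcnt, ih]; ring

lemma wval_eq (m : ℤ) (k : ℕ) (w : List Bool) (h : 3 * (2 * k - wcnt w) ≤ m - wsize w)
    (he : sixF m (wsize w) - 6 * gsum m (2 * k) w ≤ 6 * wval m w) :
    (wcnt w ≤ k → ∃ j c : ℕ, w = List.replicate j false ++ List.replicate c true) ∧
    (k < wcnt w → m - wsize w = 3 * (2 * k - wcnt w) ∧
      ∃ i j : ℕ, w = List.replicate i true ++ List.replicate j false ++ List.replicate k true) := by
  induction w with
  | nil =>
    refine ⟨fun _ => ⟨0, 0, by simp⟩, fun h => ?_⟩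
    simp [wcnt] at h; omega
  | cons b w ih =>
    have h0 := wcnt_nonneg w
    have h1 := wcnt_le w
    cases b
    · simp only [wval, sixF, gsum, wsize, wcnt, if_false, Bool.false_eq_true] at *
      have := ih (by linarith) (by nlinarith)
      refine ⟨fun hk => ?_, fun hk => ?_⟩
      · obtain ⟨j, c, e⟩ := this.1 (by linarith)
        exact ⟨j + 1, c, by rw [e]; simp [List.replicate_succ]⟩
      · have := (this.2 (by linarith)).1
        linarith
    · simp only [wval, sixF, gsum, wsize, wcnt, if_true] at *
      have hle := wval_le m k w (by linarith)
      have h2 := gmin_le m (2 * k) (wcnt w) (wsize w) h0 h1 (by linarith)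
      simp only [sixF] at hle
      have ih := ih (by linarith) (by nlinarith)
      have h3 := gmin_eq m k (wcnt w) (wsize w) h0 h1 (by linarith) (by nlinarith)
      refine ⟨fun hk => ?_, fun hk => ⟨?_, ?_⟩⟩
      · have e := replicate_of_tight w (h3.1 (by linarith))
        exact ⟨0, w.length + 1, by rw [e]; simp [List.replicate_succ]⟩
      · have := h3.2 (by omega)
        linarith
      · rcases eq_or_lt_of_le (show (k : ℤ) ≤ wcnt w by omega) with hk' | hk'
        · obtain ⟨j, c, e⟩ := ih.1 (by linarith)
          have hc : wcnt w = c := by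
            rw [e]
            clear * -
            induction j with
            | zero => simp [wcnt_replicate_true]
            | succ j ih => simp [List.replicate_succ, wcnt, ih]
          have : c = k := by omega
          subst this
          exact ⟨1, j, by rw [e]; simp⟩
        · obtain ⟨i, j, e⟩ := (ih.2 hk').2
          exact ⟨i + 1, j, by rw [e]; simp [List.replicate_succ]⟩

/-- the extremal word -/
def extW (k q : ℕ) : List Bool :=
  List.replicate k true ++ List.replicate q false ++ List.replicate k true

lemma wsize_append (u w : List Bool) : wsize (u ++ w) = wsize u + wsize w := by
  induction u with
  | nil => simp [wsize]
  | cons b u ih => simp only [List.cons_append, wsize, ih]; ring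

lemma wcnt_append (u w : List Bool) : wcnt (u ++ w) = wcnt u + wcnt w := by
  induction u with
  | nil => simp [wcnt]
  | cons b u ih => simp only [List.cons_append, wcnt, ih]; ring

lemma wsize_replicate (k : ℕ) (b : Bool) :
    wsize (List.replicate k b) = k * (if b then 3 else 1) := by
  induction k with
  | zero => simp [wsize]
  | succ k ih => simp only [List.replicate_succ, wsize, ih]; push_cast; ring

lemma wcnt_replicate (k : ℕ) (b : Bool) :
    wcnt (List.replicate k b) = k * (if b then 1 else 0) := by
  induction k with
  | zero => simp [wcnt]
  | succ k ih => simp only [List.replicate_succ, wcnt, ih]; push_cast; ring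

/-- value of appending triangles on top -/
lemma wval_replicate_true (m : ℤ) (i : ℕ) (w : List Bool) :
    2 * wval m (List.replicate i true ++ w) = 2 * wval m w +
      (2 * i * (wsize w * (m - 3 - wsize w) + (m - 3))
        + 3 * i * (i - 1) * (m - 3 - 2 * wsize w) - 3 * i * (i - 1) * (2 * i - 1)) := by
  induction i with
  | zero => simp
  | succ i ih =>
    simp only [List.replicate_succ, List.cons_append, wval, if_true]
    rw [wsize_append, wsize_replicate]
    push_cast
    try simp only [if_true]
    linarith

lemma wval_replicate_false (m : ℤ) (i : ℕ) (w : List Bool) :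
    6 * wval m (List.replicate i false ++ w) = 6 * wval m w +
      (6 * i * (wsize w * (m - 1 - wsize w))
        + 3 * i * (i - 1) * (m - 1 - 2 * wsize w) - i * (i - 1) * (2 * i - 1)) := by
  induction i with
  | zero => simp
  | succ i ih =>
    simp only [List.replicate_succ, List.cons_append, wval, if_false, Bool.false_eq_true]
    rw [wsize_append, wsize_replicate]
    push_cast
    try simp only [if_false, Bool.false_eq_true]
    linarith

/-- the closed form (times six), `W = value + m(m-1)/2` with `m = 6 * k + q` -/
lemma wval_extW (k q : ℕ) (n : ℤ) (hn : n = 4 * k + q + 1) :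
    6 * wval (6 * k + q) (extW k q) + 3 * (6 * k + q) * (6 * k + q - 1) =
      n ^ 3 - 3 * n ^ 2 + 2 * n + 6 * k * n ^ 2 - 24 * k ^ 2 * n + 8 * k ^ 3 + 48 * k ^ 2
        - 20 * k := by
  subst hn
  unfold extW
  rw [List.append_assoc]
  have h1 := wval_replicate_true (6 * k + q) k (List.replicate q false ++ List.replicate k true)
  have h2 := wval_replicate_false (6 * k + q) q (List.replicate k true)
  have h3 := wval_replicate_true (6 * k + q) k []
  rw [List.append_nil] at h3
  rw [wsize_append, wsize_replicate, wsize_replicate] at h1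
  rw [wsize_replicate] at h2
  simp only [wsize, wval, if_true, if_false, Bool.false_eq_true] at h1 h2 h3
  linarith

lemma gsum_eq_of_cnt (m t : ℤ) (u w : List Bool) (h : wcnt u = wcnt w) :
    gsum m t u = gsum m t w := by
  have key : ∀ w : List Bool, gsum m t w = ∑ p ∈ Finset.range (wcnt w).toNat, gmin m t p := by
    intro w
    induction w with
    | nil => simp [gsum, wcnt]
    | cons b w ih =>
      have h0 := wcnt_nonneg w
      cases b
      · simp [gsum, wcnt, ih]
      · simp only [gsum, wcnt, if_true, ih]
        rw [show (1 + wcnt w).toNat = (wcnt w).toNat + 1 by omega, Finset.sum_range_succ]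
        simp [h0]
  rw [key u, key w, h]

lemma wsize_extW (k q : ℕ) : wsize (extW k q) = 6 * k + q := by
  simp [extW, wsize_append, wsize_replicate]; ring

lemma wcnt_extW (k q : ℕ) : wcnt (extW k q) = 2 * k := by
  simp [extW, wcnt_append, wcnt_replicate]; ring

lemma tight_true (m t : ℤ) (w : List Bool)
    (h : sixF m (wsize w) - 6 * gsum m t w = 6 * wval m w)
    (hg : 2 * wsize w * (m - 3 - wsize w) + 2 * m - 5 = gmin m t (wcnt w)) :
    sixF m (wsize (true :: w)) - 6 * gsum m t (true :: w) = 6 * wval m (true :: w) := by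
  simp only [wval, sixF, gsum, wsize, if_true] at *
  rw [← hg]; linarith

lemma tight_false (m t : ℤ) (w : List Bool)
    (h : sixF m (wsize w) - 6 * gsum m t w = 6 * wval m w) :
    sixF m (wsize (false :: w)) - 6 * gsum m t (false :: w) = 6 * wval m (false :: w) := by
  simp only [wval, sixF, gsum, wsize, if_false, Bool.false_eq_true] at *
  linarith

lemma wval_extW_eq (m : ℤ) (k q : ℕ) (hm : m = 6 * k + q) :
    sixF m m - 6 * gsum m (2 * k) (extW k q) = 6 * wval m (extW k q) := by
  have h1 : ∀ c : ℕ, c ≤ k → sixF m (wsize (List.replicate c true))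
      - 6 * gsum m (2 * k) (List.replicate c true) = 6 * wval m (List.replicate c true) := by
    intro c
    induction c with
    | zero => intro _; simp [wval, sixF, gsum, wsize]
    | succ c ih =>
      intro hc
      rw [List.replicate_succ]
      apply tight_true _ _ _ (ih (by omega))
      rw [wsize_replicate, wcnt_replicate]
      simp only [if_true]
      unfold gmin
      rw [min_eq_left (by push_cast; omega)]
      ring
  have h2 : ∀ j : ℕ, sixF m (wsize (List.replicate j false ++ List.replicate k true))
      - 6 * gsum m (2 * k) (List.replicate j false ++ List.replicate k true)
        = 6 * wval m (List.replicate j false ++ List.replicate k true) := by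
    intro j
    induction j with
    | zero => simpa using h1 k le_rfl
    | succ j ih =>
      rw [List.replicate_succ, List.cons_append]
      exact tight_false _ _ _ ih
  have h3 : ∀ i : ℕ, i ≤ k →
      sixF m (wsize (List.replicate i true ++ (List.replicate q false ++ List.replicate k true)))
      - 6 * gsum m (2 * k)
          (List.replicate i true ++ (List.replicate q false ++ List.replicate k true))
        = 6 * wval m
          (List.replicate i true ++ (List.replicate q false ++ List.replicate k true)) := by
    intro i
    induction i with
    | zero => intro _; simpa using h2 q
    | succ i ih =>
      intro hi
      rw [List.replicate_succ, List.cons_append]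
      apply tight_true _ _ _ (ih (by omega))
      rw [wsize_append, wsize_append, wcnt_append, wcnt_append, wsize_replicate, wcnt_replicate,
        wsize_replicate, wcnt_replicate, wsize_replicate, wcnt_replicate]
      simp only [if_true, if_false, Bool.false_eq_true]
      unfold gmin
      rw [min_eq_right (by push_cast; omega), hm]
      ring
  have h4 := h3 k le_rfl
  rw [← List.append_assoc] at h4
  change sixF m (wsize (extW k q)) - 6 * gsum m (2 * k) (extW k q) = 6 * wval m (extW k q) at h4
  rwa [wsize_extW, ← hm] at h4

/-- the numeric main inequality -/
lemma wval_main (m : ℤ) (k q : ℕ) (hm : m = 6 * k + q) (w : List Bool) (hs : wsize w = m)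
    (hc : wcnt w = 2 * k) :
    wval m w ≤ wval m (extW k q) ∧ (wval m w = wval m (extW k q) → w = extW k q) := by
  have h1 := wval_le m k w (by rw [hs, hc]; simp)
  have h2 := gsum_eq_of_cnt m (2 * k) w (extW k q) (by rw [hc, wcnt_extW])
  have h3 := wval_extW_eq m k q hm
  rw [hs, h2, h3] at h1
  refine ⟨by linarith, fun he => ?_⟩
  have h4 := wval_eq m k w (by rw [hs, hc]; simp) (by rw [hs, h2, h3, he])
  rcases Nat.eq_zero_or_pos k with hk | hk
  · subst hk
    obtain ⟨j, c, e⟩ := h4.1 (by rw [hc]; simp)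
    have hs' := hs
    rw [e, wsize_append, wsize_replicate, wsize_replicate] at hs'
    rw [e, wcnt_append, wcnt_replicate, wcnt_replicate] at hc
    simp at hc hs'
    have : j = q := by
      have : (j : ℤ) = q := by rw [hc] at hs'; simp at hs'; simp at hm; omega
      exact_mod_cast this
    rw [e, hc, this]; simp [extW]
  · obtain ⟨_, i, j, e⟩ := h4.2 (by rw [hc]; omega)
    have hs' := hs
    rw [e, wsize_append, wsize_append, wsize_replicate, wsize_replicate, wsize_replicate] at hs'
    rw [e, wcnt_append, wcnt_append, wcnt_replicate, wcnt_replicate, wcnt_replicate] at hc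
    simp at hc hs'
    have hi : i = k := by omega
    have hj : j = q := by omega
    rw [e, hi, hj]; rfl
/-! ### Distances and sums over edge sets -/

/-- minimum distance between endpoints of two edges -/
noncomputable def hd {V : Type*} (G : SimpleGraph V) (e f : Sym2 V) : ℕ :=
  sInf {n : ℕ | ∃ u ∈ e, ∃ w ∈ f, G.dist u w = n}

lemma hd_le {V : Type*} (G : SimpleGraph V) {e f : Sym2 V} {u w : V} (hu : u ∈ e) (hw : w ∈ f) :
    hd G e f ≤ G.dist u w :=
  Nat.sInf_le ⟨u, hu, w, hw, rfl⟩

lemma hd_mem {V : Type*} (G : SimpleGraph V) (e f : Sym2 V) :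
    ∃ u ∈ e, ∃ w ∈ f, G.dist u w = hd G e f := by
  have : {n : ℕ | ∃ u ∈ e, ∃ w ∈ f, G.dist u w = n}.Nonempty := by
    induction e with | _ a b =>
    induction f with | _ c d =>
    exact ⟨_, a, by simp, c, by simp, rfl⟩
  exact Nat.sInf_mem this

lemma vDist_le {V : Type*} (G : SimpleGraph V) {v : V} {f : Sym2 V} {w : V} (hw : w ∈ f) :
    vDist G v f ≤ G.dist v w :=
  Nat.sInf_le ⟨w, hw, rfl⟩

lemma vDist_mem {V : Type*} (G : SimpleGraph V) (v : V) (f : Sym2 V) :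
    ∃ w ∈ f, G.dist v w = vDist G v f := by
  have : {n : ℕ | ∃ u ∈ f, G.dist v u = n}.Nonempty := by
    induction f with | _ c d =>
    exact ⟨_, c, by simp, rfl⟩
  exact Nat.sInf_mem this

lemma hd_comm {V : Type*} (G : SimpleGraph V) (e f : Sym2 V) : hd G e f = hd G f e := by
  apply le_antisymm
  · obtain ⟨u, hu, w, hw, h⟩ := hd_mem G f e
    rw [← h, SimpleGraph.dist_comm]; exact hd_le G hw hu
  · obtain ⟨u, hu, w, hw, h⟩ := hd_mem G e f
    rw [← h, SimpleGraph.dist_comm]; exact hd_le G hw hu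

lemma hd_self {V : Type*} (G : SimpleGraph V) (e : Sym2 V) : hd G e e = 0 := by
  induction e with | _ a b =>
  have := hd_le G (e := s(a, b)) (f := s(a, b)) (u := a) (w := a) (by simp) (by simp)
  simpa using this

lemma eDist_eq {V : Type*} (G : SimpleGraph V) (e f : Sym2 V) :
    (eDist G e f : ℤ) = hd G e f + (if e = f then 0 else 1) := by
  unfold eDist
  split_ifs with h
  · subst h; simp [hd_self]
  · simp [hd]

lemma vDist_of_mem {V : Type*} (G : SimpleGraph V) {r : V} {e : Sym2 V} (h : r ∈ e) :
    vDist G r e = 0 := by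
  have := vDist_le G (v := r) h
  simpa using this

lemma hd_le_of_mem {V : Type*} (G : SimpleGraph V) {r : V} {e f : Sym2 V} (h : r ∈ e) :
    hd G e f ≤ vDist G r f := by
  obtain ⟨w, hw, e⟩ := vDist_mem G r f
  rw [← e]; exact hd_le G h hw

lemma hd_le_add {V : Type*} {G : SimpleGraph V} (hG : G.Connected) (r r' : V) (e f : Sym2 V) :
    hd G e f ≤ vDist G r e + G.dist r r' + vDist G r' f := by
  obtain ⟨w, hw, e1⟩ := vDist_mem G r e
  obtain ⟨w', hw', e2⟩ := vDist_mem G r' f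
  have h1 := hG.dist_triangle (u := w) (v := r) (w := w')
  have h2 := hG.dist_triangle (u := r) (v := r') (w := w')
  have h3 := hd_le G hw hw'
  have h4 := SimpleGraph.dist_comm (G := G) (u := w) (v := r)
  omega

lemma vDist_le_add {V : Type*} {G : SimpleGraph V} (hG : G.Connected) (r r' : V) (f : Sym2 V) :
    vDist G r f ≤ G.dist r r' + vDist G r' f := by
  obtain ⟨w', hw', e2⟩ := vDist_mem G r' f
  rw [← e2]
  exact (vDist_le G hw').trans hG.dist_triangle

/-- sum of distances from a vertex to an edge set -/
noncomputable def sD {V : Type*} (G : SimpleGraph V) (r : V) (S : Finset (Sym2 V)) : ℤ :=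
  ∑ f ∈ S, (vDist G r f : ℤ)

/-- sum of distances between two edge sets -/
noncomputable def sX {V : Type*} (G : SimpleGraph V) (S T : Finset (Sym2 V)) : ℤ :=
  ∑ e ∈ S, ∑ f ∈ T, (hd G e f : ℤ)

noncomputable def sH {V : Type*} (G : SimpleGraph V) (S : Finset (Sym2 V)) : ℤ := sX G S S

section sums
variable {V : Type*} {G : SimpleGraph V}

lemma sD_empty (r : V) : sD G r ∅ = 0 := by simp [sD]
lemma sH_empty : sH G ∅ = 0 := by simp [sH, sX]

lemma sD_union {r : V} {S T : Finset (Sym2 V)} (h : Disjoint S T) :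
    sD G r (S ∪ T) = sD G r S + sD G r T := Finset.sum_union h

lemma sD_insert {r : V} {e : Sym2 V} {S : Finset (Sym2 V)} (h : e ∉ S) :
    sD G r (insert e S) = vDist G r e + sD G r S := Finset.sum_insert h

lemma sX_comm (S T : Finset (Sym2 V)) : sX G S T = sX G T S := by
  unfold sX
  rw [Finset.sum_comm]
  simp_rw [hd_comm G]

lemma sX_union_left {S T U : Finset (Sym2 V)} (h : Disjoint S T) :
    sX G (S ∪ T) U = sX G S U + sX G T U := Finset.sum_union h

lemma sX_union_right {S T U : Finset (Sym2 V)} (h : Disjoint S T) :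
    sX G U (S ∪ T) = sX G U S + sX G U T := by
  rw [sX_comm, sX_union_left h, sX_comm S, sX_comm T]

lemma sH_union {S T : Finset (Sym2 V)} (h : Disjoint S T) :
    sH G (S ∪ T) = sH G S + sH G T + 2 * sX G S T := by
  unfold sH
  rw [sX_union_left h, sX_union_right h, sX_union_right h, sX_comm T S]; ring

lemma sH_singleton (e : Sym2 V) : sH G {e} = 0 := by simp [sH, sX, hd_self]

lemma sH_insert {e : Sym2 V} {S : Finset (Sym2 V)} (h : e ∉ S) :
    sH G (insert e S) = sH G S + 2 * sX G {e} S := by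
  rw [Finset.insert_eq, sH_union (by simpa using h), sH_singleton]; ring

lemma sX_insert_right {e f : Sym2 V} {S : Finset (Sym2 V)} (h : f ∉ S) :
    sX G {e} (insert f S) = hd G e f + sX G {e} S := by
  simp [sX, Finset.sum_insert h]

lemma sD_nonneg (r : V) (S : Finset (Sym2 V)) : 0 ≤ sD G r S :=
  Finset.sum_nonneg fun _ _ => by positivity

lemma sX_one_le {e : Sym2 V} {r : V} (h : r ∈ e) (S : Finset (Sym2 V)) :
    sX G {e} S ≤ sD G r S := by
  simp only [sX, sD, Finset.sum_singleton]
  exact Finset.sum_le_sum fun f _ => by exact_mod_cast hd_le_of_mem G h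

lemma sD_le (hG : G.Connected) {r r' : V} {δ : ℤ} (h : (G.dist r r' : ℤ) ≤ δ)
    (S : Finset (Sym2 V)) : sD G r S ≤ sD G r' S + δ * S.card := by
  unfold sD
  have : ∀ f ∈ S, (vDist G r f : ℤ) ≤ vDist G r' f + δ := fun f _ => by
    have := vDist_le_add hG r r' f
    zify at this; linarith
  refine (Finset.sum_le_sum this).trans ?_
  rw [Finset.sum_add_distrib]; simp [mul_comm]

lemma sX_one_le' (hG : G.Connected) {e : Sym2 V} {r r' : V} (he : r ∈ e) {δ : ℤ}
    (h : (G.dist r r' : ℤ) ≤ δ) (S : Finset (Sym2 V)) :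
    sX G {e} S ≤ sD G r' S + δ * S.card := (sX_one_le he S).trans (sD_le hG h S)

lemma sX_le (hG : G.Connected) {r r' : V} {δ : ℤ} (h : (G.dist r r' : ℤ) ≤ δ)
    (S T : Finset (Sym2 V)) :
    sX G S T ≤ T.card * sD G r S + S.card * sD G r' T + δ * S.card * T.card := by
  unfold sX
  have h1 : ∀ e ∈ S, ∑ f ∈ T, (hd G e f : ℤ) ≤ T.card * vDist G r e + sD G r' T + δ * T.card := by
    intro e _
    have : ∀ f ∈ T, (hd G e f : ℤ) ≤ vDist G r e + vDist G r' f + δ := fun f _ => by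
      have := hd_le_add hG r r' e f
      zify at this; linarith
    refine (Finset.sum_le_sum this).trans (le_of_eq ?_)
    rw [Finset.sum_add_distrib, Finset.sum_add_distrib]; simp [sD]; ring
  refine (Finset.sum_le_sum h1).trans (le_of_eq ?_)
  rw [Finset.sum_add_distrib, Finset.sum_add_distrib, ← Finset.mul_sum]; simp [sD]; ring

lemma sum_eDist (S : Finset (Sym2 V)) :
    ((∑ e ∈ S, ∑ f ∈ S, eDist G e f : ℕ) : ℤ) = sH G S + S.card * (S.card - 1) := by
  push_cast
  simp_rw [eDist_eq]
  have : ∀ e ∈ S, ∑ f ∈ S, ((hd G e f : ℤ) + if e = f then 0 else 1) =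
      ∑ f ∈ S, (hd G e f : ℤ) + (S.card - 1) := by
    intro e he
    rw [Finset.sum_add_distrib]
    congr 1
    have : ∀ f ∈ S, (if e = f then (0 : ℤ) else 1) = 1 - if e = f then 1 else 0 := by
      intro f _; split_ifs <;> simp
    rw [Finset.sum_congr rfl this, Finset.sum_sub_distrib]
    simp [he]
  rw [Finset.sum_congr rfl this, Finset.sum_add_distrib]
  simp [sH, sX]; ring

end sums

/-! ### Induced edge sets -/

/-- the restriction of `G` to a vertex set, keeping the vertex type -/
def gA {V : Type*} (G : SimpleGraph V) (A : Finset V) : SimpleGraph V where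
  Adj x y := G.Adj x y ∧ x ∈ A ∧ y ∈ A
  symm := ⟨fun _ _ h => ⟨h.1.symm, h.2.2, h.2.1⟩⟩
  loopless := ⟨fun _ h => G.loopless.irrefl _ h.1⟩

noncomputable def eA {V : Type*} [Fintype V] (G : SimpleGraph V) (A : Finset V) : Finset (Sym2 V) :=
  (gA G A).edgeFinset

lemma gA_mono {V : Type*} (G : SimpleGraph V) {A B : Finset V} (h : A ⊆ B) : gA G A ≤ gA G B :=
  fun _ _ h' => ⟨h'.1, h h'.2.1, h h'.2.2⟩

lemma gA_le {V : Type*} (G : SimpleGraph V) (A : Finset V) : gA G A ≤ G := fun _ _ h' => h'.1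

lemma mem_eA {V : Type*} [Fintype V] {G : SimpleGraph V} {A : Finset V} {x y : V} :
    s(x, y) ∈ eA G A ↔ G.Adj x y ∧ x ∈ A ∧ y ∈ A := by
  unfold eA; rw [SimpleGraph.mem_edgeFinset, SimpleGraph.mem_edgeSet]; rfl

lemma eA_univ {V : Type*} [Fintype V] (G : SimpleGraph V) : eA G Finset.univ = G.edgeFinset := by
  ext e
  induction e with | _ x y =>
  rw [mem_eA]; simp

lemma eA_singleton {V : Type*} [Fintype V] (G : SimpleGraph V) (r : V) : eA G {r} = ∅ := by
  ext e
  induction e with | _ x y =>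
  rw [mem_eA]
  simp only [mem_singleton, notMem_empty, iff_false]
  rintro ⟨h, rfl, rfl⟩
  exact G.loopless.irrefl _ h
/-! ### Connectivity of vertex sets, splitting -/

section conn
variable {V : Type*} [Fintype V] {G : SimpleGraph V}

def cA (G : SimpleGraph V) (A : Finset V) : Prop :=
  ∀ x ∈ A, ∀ y ∈ A, (gA G A).Reachable x y

lemma cA_of_root {A : Finset V} (r : V) (h : ∀ z ∈ A, (gA G A).Reachable r z) : cA G A :=
  fun x hx y hy => (h x hx).symm.trans (h y hy)

lemma reach_ind {K : SimpleGraph V} {x : V} {P : V → Prop} (h0 : P x)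
    (hs : ∀ a b, K.Reachable x a → K.Adj a b → P a → P b) {z : V} (h : K.Reachable x z) : P z := by
  rw [SimpleGraph.reachable_iff_reflTransGen] at h
  induction h with
  | refl => exact h0
  | tail hab hbc ih =>
    exact hs _ _ ((SimpleGraph.reachable_iff_reflTransGen _ _).2 hab) hbc ih

noncomputable def cmpt (K : SimpleGraph V) (x : V) : Finset V :=
  Finset.univ.filter (fun z => K.Reachable x z)

lemma mem_cmpt {K : SimpleGraph V} {x z : V} : z ∈ cmpt K x ↔ K.Reachable x z := by simp [cmpt]

lemma cmpt_reach {K : SimpleGraph V} (hK : K ≤ G) {x z : V} (h : K.Reachable x z) :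
    (gA G (cmpt K x)).Reachable x z := by
  refine reach_ind (P := fun z => (gA G (cmpt K x)).Reachable x z)
    (SimpleGraph.Reachable.refl _) ?_ h
  intro a b ha hab ih
  refine ih.trans (SimpleGraph.Adj.reachable ⟨hK hab, mem_cmpt.2 ha, mem_cmpt.2 (ha.trans hab.reachable)⟩)

lemma cmpt_cA {K : SimpleGraph V} (hK : K ≤ G) (x : V) : cA G (cmpt K x) :=
  cA_of_root x fun _ hz => cmpt_reach hK (mem_cmpt.1 hz)

lemma cmpt_sub {K : SimpleGraph V} {C : Finset V} (hK : K ≤ gA G C) {x : V} (hx : x ∈ C) :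
    cmpt K x ⊆ C := by
  intro z hz
  exact reach_ind (P := fun z => z ∈ C) hx (fun a b _ hab _ => (hK hab).2.2) (mem_cmpt.1 hz)

lemma eA_mono {A B : Finset V} (h : A ⊆ B) : eA G A ⊆ eA G B := by
  intro e
  induction e with | _ x y =>
  rw [mem_eA, mem_eA]
  exact fun h' => ⟨h'.1, h h'.2.1, h h'.2.2⟩

lemma eA_disj {A B : Finset V} {r : V} (h : ∀ x, x ∈ A → x ∈ B → x = r) :
    Disjoint (eA G A) (eA G B) := by
  rw [Finset.disjoint_left]
  intro e
  induction e with | _ x y =>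
  rw [mem_eA, mem_eA]
  rintro ⟨h1, h2, h3⟩ ⟨_, h4, h5⟩
  rw [h x h2 h4, h y h3 h5] at h1
  exact G.loopless.irrefl _ h1

lemma notMem_eA_left {A : Finset V} {x y : V} (h : x ∉ A) : s(x, y) ∉ eA G A := by
  rw [mem_eA]; tauto

lemma notMem_eA_right {A : Finset V} {x y : V} (h : y ∉ A) : s(x, y) ∉ eA G A := by
  rw [mem_eA]; tauto

/-- splitting along a bridge -/
lemma bridge_split {C : Finset V} (hC : cA G C) {x y : V} (hxy : G.Adj x y) (hx : x ∈ C)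
    (hy : y ∈ C) (hb : (gA G C).IsBridge s(x, y)) :
    ∃ B D : Finset V, x ∈ B ∧ y ∈ D ∧ Disjoint B D ∧ B ∪ D = C ∧ cA G B ∧ cA G D ∧
      eA G C = insert s(x, y) (eA G B ∪ eA G D) ∧ s(x, y) ∉ eA G B ∪ eA G D ∧
      Disjoint (eA G B) (eA G D) ∧
      (∀ a ∈ B, ∀ b ∈ D, G.Adj a b → a = x ∧ b = y) ∧
      (∀ z (p : G.Walk y z), (∀ e ∈ p.edges, e ∈ eA G C) → s(x, y) ∉ p.edges →
        ∀ v ∈ p.support, v ∈ D) := by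
  set K := (gA G C).deleteEdges {s(x, y)} with hK
  have hKC : K ≤ gA G C := SimpleGraph.deleteEdges_le _
  have hKG : K ≤ G := hKC.trans (gA_le G C)
  have hnr : ¬ K.Reachable x y := hb
  have hKadj : ∀ a b, K.Adj a b ↔ (G.Adj a b ∧ a ∈ C ∧ b ∈ C) ∧ s(a, b) ≠ s(x, y) := by
    intro a b
    rw [hK, SimpleGraph.deleteEdges_adj]; simp [gA]
  have hor : ∀ z ∈ C, K.Reachable x z ∨ K.Reachable y z := by
    intro z hz
    refine reach_ind (P := fun z => K.Reachable x z ∨ K.Reachable y z)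
      (Or.inl (SimpleGraph.Reachable.refl _)) ?_ (hC x hx z hz)
    intro a b _ hab ih
    by_cases he : s(a, b) = s(x, y)
    · rw [Sym2.eq_iff] at he
      rcases he with ⟨_, rfl⟩ | ⟨_, rfl⟩
      · exact Or.inr (SimpleGraph.Reachable.refl _)
      · exact Or.inl (SimpleGraph.Reachable.refl _)
    · have : K.Adj a b := (hKadj a b).2 ⟨hab, he⟩
      exact ih.imp (fun h => h.trans this.reachable) (fun h => h.trans this.reachable)
  have hdis : Disjoint (cmpt K x) (cmpt K y) := by
    rw [Finset.disjoint_left]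
    intro z h1 h2
    exact hnr ((mem_cmpt.1 h1).trans (mem_cmpt.1 h2).symm)
  have hun : cmpt K x ∪ cmpt K y = C := by
    apply Finset.Subset.antisymm
    · exact Finset.union_subset (cmpt_sub hKC hx) (cmpt_sub hKC hy)
    · intro z hz
      rw [Finset.mem_union, mem_cmpt, mem_cmpt]; exact hor z hz
  have hBC : cmpt K x ⊆ C := cmpt_sub hKC hx
  have hDC : cmpt K y ⊆ C := cmpt_sub hKC hy
  have hcross : ∀ a ∈ cmpt K x, ∀ b ∈ cmpt K y, G.Adj a b → a = x ∧ b = y := by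
    intro a ha b hb hab
    by_cases he : s(a, b) = s(x, y)
    · rw [Sym2.eq_iff] at he
      rcases he with h | ⟨rfl, rfl⟩
      · exact h
      · exact absurd (mem_cmpt.1 ha) hnr
    · have : K.Adj a b := (hKadj a b).2 ⟨⟨hab, hBC ha, hDC hb⟩, he⟩
      exact absurd (((mem_cmpt.1 ha).trans this.reachable).trans (mem_cmpt.1 hb).symm) hnr
  have hxB : x ∈ cmpt K x := mem_cmpt.2 (SimpleGraph.Reachable.refl _)
  have hyD : y ∈ cmpt K y := mem_cmpt.2 (SimpleGraph.Reachable.refl _)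
  refine ⟨cmpt K x, cmpt K y, hxB, hyD, hdis, hun, cmpt_cA hKG x, cmpt_cA hKG y, ?_, ?_, ?_,
    hcross, ?_⟩
  · ext e
    induction e with | _ a b =>
    simp only [Finset.mem_insert, Finset.mem_union, mem_eA]
    constructor
    · rintro ⟨h1, h2, h3⟩
      rw [← hun, Finset.mem_union] at h2 h3
      rcases h2 with h2 | h2 <;> rcases h3 with h3 | h3
      · exact Or.inr (Or.inl ⟨h1, h2, h3⟩)
      · obtain ⟨rfl, rfl⟩ := hcross a h2 b h3 h1; exact Or.inl rfl
      · obtain ⟨rfl, rfl⟩ := hcross b h3 a h2 h1.symm; exact Or.inl Sym2.eq_swap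
      · exact Or.inr (Or.inr ⟨h1, h2, h3⟩)
    · rintro (h | h | h)
      · rw [Sym2.eq_iff] at h
        rcases h with ⟨rfl, rfl⟩ | ⟨rfl, rfl⟩
        · exact ⟨hxy, hx, hy⟩
        · exact ⟨hxy.symm, hy, hx⟩
      · exact ⟨h.1, hBC h.2.1, hBC h.2.2⟩
      · exact ⟨h.1, hDC h.2.1, hDC h.2.2⟩
  · rw [Finset.mem_union, not_or]
    exact ⟨notMem_eA_right (fun h => Finset.disjoint_left.1 hdis h hyD),
      notMem_eA_left (fun h => Finset.disjoint_left.1 hdis hxB h)⟩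
  · exact eA_disj (r := x) fun z h1 h2 => absurd h2 (Finset.disjoint_left.1 hdis h1)
  · intro z p hp1 hp2 v hv
    have hall : ∀ e ∈ p.edges, e ∈ K.edgeSet := by
      intro e he
      have h1 := hp1 e he
      have h2 : e ≠ s(x, y) := fun h => hp2 (h ▸ he)
      induction e with | _ a b =>
      rw [mem_eA] at h1
      exact (hKadj a b).2 ⟨h1, h2⟩
    let p' := p.transfer K hall
    have hv' : v ∈ p'.support := by simpa [p'] using hv
    exact mem_cmpt.2 ⟨p'.takeUntil v hv'⟩

lemma exists_nbr {C : Finset V} {r : V} (hA : cA G (insert r C)) {z : V}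
    (hz : z ∈ C) (hr : r ∉ C) : ∃ u ∈ C, G.Adj r u ∧ (gA G C).Reachable u z := by
  have h := hA r (by simp) z (by simp [hz])
  have : z = r ∨ ∃ u ∈ C, G.Adj r u ∧ (gA G C).Reachable u z := by
    refine reach_ind (P := fun z => z = r ∨ ∃ u ∈ C, G.Adj r u ∧ (gA G C).Reachable u z)
      (Or.inl rfl) ?_ h
    intro a b _ hab ih
    by_cases hbr : b = r
    · exact Or.inl hbr
    · right
      have hb : b ∈ C := by
        have := hab.2.2
        rw [Finset.mem_insert] at this; tauto
      rcases ih with rfl | ⟨u, hu, hru, hua⟩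
      · exact ⟨b, hb, hab.1, SimpleGraph.Reachable.refl _⟩
      · by_cases har : a = r
        · subst har
          exact ⟨b, hb, hab.1, SimpleGraph.Reachable.refl _⟩
        · have ha : a ∈ C := by
            have := hab.2.1
            rw [Finset.mem_insert] at this; tauto
          exact ⟨u, hu, hru, hua.trans (SimpleGraph.Adj.reachable ⟨hab.1, ha, hb⟩)⟩
  rcases this with rfl | h
  · exact absurd hz hr
  · exact h

/-- splitting at a cut vertex -/
lemma vertex_split {C : Finset V} {r : V} (hr : r ∉ C) (hA : cA G (insert r C)) (hC : ¬ cA G C) :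
    ∃ B D : Finset V, B.Nonempty ∧ D.Nonempty ∧ Disjoint B D ∧ B ∪ D = C ∧
      cA G (insert r B) ∧ cA G (insert r D) ∧
      eA G (insert r C) = eA G (insert r B) ∪ eA G (insert r D) ∧
      Disjoint (eA G (insert r B)) (eA G (insert r D)) ∧
      (∀ a ∈ B, ∀ b ∈ D, ¬ G.Adj a b) := by
  simp only [cA, not_forall] at hC
  obtain ⟨x, hx, y, hy, hxy⟩ := hC
  set K := gA G C with hK
  have hKG : K ≤ G := gA_le G C
  have hsub : ∀ z ∈ C, cmpt K z ⊆ C := fun z hz => cmpt_sub le_rfl hz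
  have hBC := hsub x hx
  have hxB : x ∈ cmpt K x := mem_cmpt.2 (SimpleGraph.Reachable.refl _)
  have hdis : Disjoint (cmpt K x) (C \ cmpt K x) := Finset.disjoint_sdiff
  have hcross : ∀ a ∈ cmpt K x, ∀ b ∈ C \ cmpt K x, ¬ G.Adj a b := by
    intro a ha b hb hab
    rw [Finset.mem_sdiff] at hb
    exact hb.2 (mem_cmpt.2 ((mem_cmpt.1 ha).trans
      (SimpleGraph.Adj.reachable (⟨hab, hBC ha, hb.1⟩ : K.Adj a b))))
  -- any vertex reaches r inside its own component
  have key : ∀ z ∈ C, ∀ S : Finset V, cmpt K z ⊆ S → (gA G (insert r S)).Reachable r z := by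
    intro z hz S hS
    obtain ⟨u, hu, hru, huz⟩ := exists_nbr hA hz hr
    have h1 := cmpt_reach hKG huz.symm
    have h2 : (gA G (insert r S)).Reachable z u :=
      h1.mono (gA_mono G (hS.trans (Finset.subset_insert _ _)))
    have huS : u ∈ S := hS (mem_cmpt.2 huz.symm)
    have h3 : (gA G (insert r S)).Adj r u := ⟨hru, by simp, by simp [huS]⟩
    exact h3.reachable.trans h2.symm
  have cmpt_eq : ∀ z ∈ cmpt K x, cmpt K z ⊆ cmpt K x := by
    intro z hz v hv
    exact mem_cmpt.2 ((mem_cmpt.1 hz).trans (mem_cmpt.1 hv))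
  have cmpt_eq2 : ∀ z ∈ C \ cmpt K x, cmpt K z ⊆ C \ cmpt K x := by
    intro z hz v hv
    rw [Finset.mem_sdiff] at hz ⊢
    exact ⟨hsub z hz.1 hv, fun h => hz.2 (mem_cmpt.2 ((mem_cmpt.1 h).trans (mem_cmpt.1 hv).symm))⟩
  refine ⟨cmpt K x, C \ cmpt K x, ⟨x, hxB⟩, ⟨y, by simp [hy, mem_cmpt, hxy]⟩, hdis,
    Finset.union_sdiff_of_subset hBC, ?_, ?_, ?_, ?_, hcross⟩
  · apply cA_of_root r
    intro z hz
    rw [Finset.mem_insert] at hz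
    rcases hz with rfl | hz
    · exact SimpleGraph.Reachable.refl _
    · exact key z (hBC hz) _ (cmpt_eq z hz)
  · apply cA_of_root r
    intro z hz
    rw [Finset.mem_insert] at hz
    rcases hz with rfl | hz
    · exact SimpleGraph.Reachable.refl _
    · exact key z (Finset.mem_sdiff.1 hz).1 _ (cmpt_eq2 z hz)
  · ext e
    induction e with | _ a b =>
    simp only [Finset.mem_union, mem_eA, Finset.mem_insert, Finset.mem_sdiff]
    have c1 := hcross a
    have c2 := hcross b
    simp only [Finset.mem_sdiff] at c1 c2
    constructor
    · rintro ⟨h1, h2, h3⟩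
      have h1' := h1.symm
      by_cases ha : a ∈ cmpt K x <;> by_cases hb : b ∈ cmpt K x <;> grind
    · rintro (⟨h1, h2, h3⟩ | ⟨h1, h2, h3⟩)
      · exact ⟨h1, h2.imp_right (@hBC a), h3.imp_right (@hBC b)⟩
      · exact ⟨h1, h2.imp_right And.left, h3.imp_right And.left⟩
  · apply eA_disj (r := r)
    intro z h1 h2
    rw [Finset.mem_insert] at h1 h2
    rcases h1 with h1 | h1
    · exact h1
    · rcases h2 with h2 | h2
      · exact h2
      · exact absurd h2 (Finset.disjoint_left.1 hdis h1)

lemma eA_insert_one {C : Finset V} {r u : V} (hr : r ∉ C) (hu : u ∈ C) (hru : G.Adj r u)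
    (h : ∀ v ∈ C, G.Adj r v → v = u) : eA G (insert r C) = insert s(r, u) (eA G C) := by
  ext e
  induction e with | _ a b =>
  simp only [Finset.mem_insert, mem_eA, Sym2.eq_iff]
  have h1 : ∀ v ∈ C, G.Adj v r → v = u := fun v hv hh => h v hv hh.symm
  have h2 := hru.symm
  have h3 : ∀ v, ¬ G.Adj v v := fun v => G.loopless.irrefl v
  grind

lemma eA_insert_two {C : Finset V} {r u u' : V} (hr : r ∉ C) (hu : u ∈ C) (hru : G.Adj r u)
    (hu' : u' ∈ C) (hru' : G.Adj r u')
    (h : ∀ v ∈ C, G.Adj r v → v = u ∨ v = u') :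
    eA G (insert r C) = insert s(r, u) (insert s(r, u') (eA G C)) := by
  ext e
  induction e with | _ a b =>
  simp only [Finset.mem_insert, mem_eA, Sym2.eq_iff]
  have h1 : ∀ v ∈ C, G.Adj v r → v = u ∨ v = u' := fun v hv hh => h v hv hh.symm
  have h2 := hru.symm
  have h2' := hru'.symm
  have h3 : ∀ v, ¬ G.Adj v v := fun v => G.loopless.irrefl v
  grind

lemma eq_singleton_of_eA {A : Finset V} {r : V} (hr : r ∈ A) (hA : cA G A)
    (h : (eA G A).card = 0) : A = {r} := by
  rw [Finset.card_eq_zero] at h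
  ext z
  rw [Finset.mem_singleton]
  constructor
  · intro hz
    refine reach_ind (P := fun z => z = r) rfl ?_ (hA r hr z hz)
    intro a b _ hab _
    have := mem_eA.2 hab
    rw [h] at this; simp at this
  · rintro rfl; exact hr

/-- the cactus property for two cycles with an edge in the first only -/
lemma cactus_use (hG : IsCactus G) {u w : V} (c1 : G.Walk u u) (c2 : G.Walk w w) (h1 : c1.IsCycle)
    (h2 : c2.IsCycle) {e : Sym2 V} (he1 : e ∈ c1.edges) (he2 : e ∉ c2.edges) {a b : V}
    (hab : a ≠ b) (ha1 : a ∈ c1.support) (ha2 : a ∈ c2.support) (hb1 : b ∈ c1.support)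
    (hb2 : b ∈ c2.support) : False := by
  have := hG.2 u w c1 c2 h1 h2 (by
    intro h
    have : e ∈ c1.edges.toFinset := by simpa using he1
    rw [h] at this
    exact he2 (by simpa using this))
  have h3 : ({a, b} : Finset V) ⊆ c1.support.toFinset ∩ c2.support.toFinset := by
    intro z hz
    simp only [Finset.mem_insert, Finset.mem_singleton] at hz
    rcases hz with rfl | rfl <;> simp [*]
  have h4 := Finset.card_le_card h3
  rw [Finset.card_pair hab] at h4
  omega

lemma walk_gA_edges {C : Finset V} {a b : V} (p : (gA G C).Walk a b) :
    ∀ e ∈ p.edges, e ∈ eA G C := by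
  intro e he
  have := p.edges_subset_edgeSet he
  unfold eA; rw [SimpleGraph.mem_edgeFinset]; exact this

lemma walk_gA_support {C : Finset V} {a b : V} (p : (gA G C).Walk a b) (ha : a ∈ C) :
    ∀ v ∈ p.support, v ∈ C := by
  induction p with
  | nil => simpa using ha
  | cons h p ih =>
    intro v hv
    rw [SimpleGraph.Walk.support_cons, List.mem_cons] at hv
    rcases hv with rfl | hv
    · exact ha
    · exact ih h.2.2 v hv

/-- a vertex with two neighbours in a connected set closes a cycle -/
lemma two_nbrs (hG : IsCactus G) {C : Finset V} (hC : cA G C) {r u1 u2 : V} (hr : r ∉ C)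
    (h1 : u1 ∈ C) (h2 : u2 ∈ C) (h12 : u1 ≠ u2) (hr1 : G.Adj r u1) (hr2 : G.Adj r u2) :
    (∀ v ∈ C, G.Adj r v → v = u1 ∨ v = u2) ∧
    ∃ p : G.Walk u1 u2, p.IsPath ∧ (∀ e ∈ p.edges, e ∈ eA G C) ∧ (∀ v ∈ p.support, v ∈ C) ∧
      ∀ e ∈ p.edges, (gA G C).IsBridge e := by
  have mkp : ∀ v ∈ C, ∃ p : G.Walk u1 v, p.IsPath ∧ (∀ e ∈ p.edges, e ∈ eA G C) ∧
      (∀ z ∈ p.support, z ∈ C) := by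
    intro v hv
    obtain ⟨q, hq⟩ := (hC u1 h1 v hv).exists_isPath
    refine ⟨q.mapLe (gA_le G C), (SimpleGraph.Walk.isPath_mapLe _).2 hq, ?_, ?_⟩
    · intro e he
      exact walk_gA_edges q e (by simpa using he)
    · intro z hz
      exact walk_gA_support q h1 z (by simpa using hz)
  have mkc : ∀ v, v ≠ u1 → ∀ (hvr : G.Adj v r), ∀ p : G.Walk u1 v, p.IsPath →
      (∀ e ∈ p.edges, e ∈ eA G C) → (∀ z ∈ p.support, z ∈ C) →
      (SimpleGraph.Walk.cons hr1 (p.concat hvr)).IsCycle := by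
    intro v hv hvr p hp he hs
    rw [SimpleGraph.Walk.cons_isCycle_iff]
    constructor
    · exact hp.concat (fun h => hr (hs r h)) hvr
    · rw [SimpleGraph.Walk.edges_concat, List.concat_eq_append, List.mem_append, not_or]
      refine ⟨fun h => notMem_eA_left hr (he _ h), ?_⟩
      simp only [List.mem_singleton, Sym2.eq_iff]
      rintro (⟨rfl, rfl⟩ | ⟨_, h⟩)
      · exact hr (hs _ p.end_mem_support)
      · exact hv h.symm
  obtain ⟨p, hp, hpe, hps⟩ := mkp u2 h2
  have hc := mkc u2 h12.symm hr2.symm p hp hpe hps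
  refine ⟨?_, p, hp, hpe, hps, ?_⟩
  · intro v hv hrv
    by_contra hcon
    push Not at hcon
    obtain ⟨p', hp', hpe', hps'⟩ := mkp v hv
    have hc' := mkc v hcon.1 hrv.symm p' hp' hpe' hps'
    refine cactus_use hG _ _ hc hc' (e := s(u2, r)) (a := r) (b := u1) (by simp) ?_ hr1.ne
      (by simp) (by simp) (by simp) (by simp)
    simp only [SimpleGraph.Walk.edges_cons, SimpleGraph.Walk.edges_concat, List.mem_cons,
      List.concat_eq_append, List.mem_append, Sym2.eq_iff, List.not_mem_nil, or_false, not_or]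
    refine ⟨?_, ?_, ?_⟩
    · have := hr2.ne
      grind
    · exact fun h => notMem_eA_right hr (hpe' _ h)
    · have := hr2.ne
      grind
  · intro e he
    induction e with | _ x y =>
    rw [SimpleGraph.isBridge_iff]
    intro hreach
    have hxy := hpe _ he
    rw [mem_eA] at hxy
    obtain ⟨z, c, hcyc, hec⟩ := SimpleGraph.adj_and_reachable_delete_edges_iff_exists_cycle.1
      ⟨(hxy : (gA G C).Adj x y), hreach⟩
    have hx : x ∈ c.support := SimpleGraph.Walk.fst_mem_support_of_mem_edges _ hec
    have hy : y ∈ c.support := SimpleGraph.Walk.snd_mem_support_of_mem_edges _ hec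
    refine cactus_use hG _ (c.mapLe (gA_le G C)) hc ((SimpleGraph.Walk.isCycle_mapLe _).2 hcyc)
      (e := s(r, u1)) (a := x) (b := y) (by simp) ?_ hxy.1.ne ?_ (by simpa using hx) ?_
      (by simpa using hy)
    · intro h
      exact notMem_eA_left hr (walk_gA_edges c _ (by simpa using h))
    · have := SimpleGraph.Walk.fst_mem_support_of_mem_edges _ he
      simp [this]
    · have := SimpleGraph.Walk.snd_mem_support_of_mem_edges _ he
      simp [this]

end conn
/-! ### The main rooted bound -/

/-- `Lin G r A w`: the set `A` induces the chain described by `w`, with top vertex `r`. -/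
inductive Lin {V : Type*} (G : SimpleGraph V) : V → Finset V → List Bool → Prop
  | nil (r : V) : Lin G r {r} []
  | bridge {u r : V} {C : Finset V} {w : List Bool} (h : Lin G u C w) (hr : r ∉ C)
      (hru : G.Adj r u) (hno : ∀ v ∈ C, G.Adj r v → v = u) : Lin G r (insert r C) (false :: w)
  | tri {u r z : V} {C : Finset V} {w : List Bool} (h : Lin G u C w) (hr : r ∉ C) (hz : z ∉ C)
      (hrz : G.Adj r z) (hru : G.Adj r u) (hzu : G.Adj z u)
      (hno : ∀ v ∈ C, G.Adj r v → v = u) (hno' : ∀ v ∈ C, G.Adj z v → v = u) :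
      Lin G r (insert r (insert z C)) (true :: w)

section main
variable {V : Type*} [Fintype V] {G : SimpleGraph V}

/-- number of edges, as an integer -/
noncomputable def nE (G : SimpleGraph V) (A : Finset V) : ℤ := ((eA G A).card : ℤ)

lemma nE_nonneg (A : Finset V) : 0 ≤ nE G A := by unfold nE; positivity

def MB (G : SimpleGraph V) (r : V) (A : Finset V) : Prop :=
  ∀ m : ℤ, nE G A < m → ∃ w : List Bool, wsize w = nE G A ∧
    wcnt w = nE G A - A.card + 1 ∧
    sH G (eA G A) + 2 * (m - nE G A) * sD G r (eA G A) ≤ 2 * wval m w ∧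
    (sH G (eA G A) + 2 * (m - nE G A) * sD G r (eA G A) = 2 * wval m w → Lin G r A w)

lemma dist_adj_le {x y : V} (h : G.Adj x y) : (G.dist x y : ℤ) ≤ 1 := by
  have := SimpleGraph.dist_eq_one_iff_adj.2 h
  omega

lemma pb_num (m n0 b Db Wb DB WB S A l v0 v vB v' : ℤ)
    (h1 : v0 + Wb + (m - (A + l)) * Db + n0 * (l * (m - n0 - 1) - 2 * S - l * (l - 1)) +
      A * (m - n0 - A - l) + S ≤ v)
    (h2 : WB = vB - (m - b) * DB)
    (h3 : 3 * (v + (n0 + (A + l)) * (m - 1 - (n0 + (A + l))) + vB) +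
      (n0 + (A + l) + 1) * b * (m - (n0 + (A + l) + 1) - b) ≤ 3 * v')
    (h4 : 0 ≤ b * (m - (n0 + (A + l) + 1) - b) * (n0 + (A + l) + 1 - 3)) (h5 : 0 ≤ A * b) :
    v0 + (Wb + Db + WB + (A + l + 1) * DB + b * (Db + (A + l))) +
      (m - (1 + b + (A + l))) * (Db + (A + l) + DB) +
      n0 * ((l + 1) * (m - n0 - 1) - 2 * (S + A) - (l + 1) * (l + 1 - 1)) +
      (A + b) * (m - n0 - (A + b) - (l + 1)) + (S + A) ≤ v' := by
  linarith

lemma path_bound (hG : G.Connected) (N : ℕ)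
    (IH : ∀ (B : Finset V) (r : V), B.card < N → r ∈ B → cA G B → MB G r B)
    (m n0 : ℤ) (hn0 : 3 ≤ n0) (w0 : List Bool) (hw0 : wsize w0 = n0) {u x : V} (p : G.Walk u x) :
    p.IsPath → ∀ C : Finset V, C.card < N → cA G C → u ∈ C → (∀ e ∈ p.edges, e ∈ eA G C) →
    (∀ e ∈ p.edges, (gA G C).IsBridge e) → n0 + nE G C ≤ m →
    ∃ (Db Wb Pb A S : ℤ) (w : List Bool), sH G (eA G C) ≤ 2 * Wb ∧ sD G u (eA G C) ≤ Db ∧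
      sD G x (eA G C) ≤ Pb ∧ nE G C = A + p.length ∧ Db - Pb = 2 * S - p.length * A ∧
      0 ≤ A ∧ S ≤ p.length * A ∧ wsize w = n0 + nE G C ∧
      wcnt w = wcnt w0 + nE G C - C.card + 1 ∧
      wval m w0 + Wb + (m - nE G C) * Db +
        n0 * (p.length * (m - n0 - 1) - 2 * S - p.length * (p.length - 1)) +
        A * (m - n0 - A - p.length) + S ≤ wval m w := by
  induction p with
  | nil =>
    rename_i u
    intro _ C hCN hC hu _ _ hm
    obtain ⟨w, hs, hc, hle, -⟩ := IH C u hCN hu hC m (by linarith)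
    obtain ⟨w', hs', hc', hle'⟩ := wmerge m w0 w (by rw [hw0, hs]; exact hm)
    rw [hw0, hs] at hle' hs'
    have hb := nE_nonneg (G := G) C
    have h1 := mul_nonneg (mul_nonneg hb (show 0 ≤ m - n0 - nE G C by linarith))
      (show 0 ≤ n0 - 3 by linarith)
    refine ⟨sD G u (eA G C), wval m w - (m - nE G C) * sD G u (eA G C), sD G u (eA G C), nE G C, 0,
      w', ?_, le_rfl, le_rfl, ?_, ?_, hb, ?_, ?_, ?_, ?_⟩
    · linarith
    · simp
    · simp
    · simp
    · exact hs'
    · rw [hc', hc]; ring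
    · simp only [SimpleGraph.Walk.length_nil, Nat.cast_zero]
      linarith
  | cons hadj p ih =>
    rename_i u u' x
    intro hp C hCN hC hu hpe hpb hm
    rw [SimpleGraph.Walk.cons_isPath_iff] at hp
    have he0 : s(u, u') ∈ eA G C := hpe _ (by simp)
    have hu' : u' ∈ C := (mem_eA.1 he0).2.2
    obtain ⟨B, D, huB, huD, hdis, hun, hB, hD, heq, hnot, hedis, hcross, hwalk⟩ :=
      bridge_split hC hadj hu hu' (hpb _ (by simp))
    have hpsup := hwalk x p (fun e he => hpe e (by simp [he])) (fun h =>
      hp.2 (SimpleGraph.Walk.fst_mem_support_of_mem_edges _ h))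
    have hDC : D ⊆ C := hun ▸ Finset.subset_union_right
    have hBC : B ⊆ C := hun ▸ Finset.subset_union_left
    have hcard : C.card = B.card + D.card := by rw [← hun, Finset.card_union_of_disjoint hdis]
    have hpeD : ∀ e ∈ p.edges, e ∈ eA G D := by
      intro e he
      induction e with | _ a b =>
      have h1 := hpe s(a, b) (by simp [he])
      rw [mem_eA] at h1 ⊢
      exact ⟨h1.1, hpsup _ (SimpleGraph.Walk.fst_mem_support_of_mem_edges _ he),
        hpsup _ (SimpleGraph.Walk.snd_mem_support_of_mem_edges _ he)⟩
    have hnE : nE G C = 1 + nE G B + nE G D := by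
      unfold nE
      rw [heq, Finset.card_insert_of_notMem hnot, Finset.card_union_of_disjoint hedis]
      push_cast; ring
    have hb := nE_nonneg (G := G) B
    have hσ := nE_nonneg (G := G) D
    obtain ⟨Db, Wb, Pb, A, S, w, hW, hDb, hPb, hA, hdiff, hA0, hS, hws, hwc, hwv⟩ :=
      ih hp.1 D (lt_of_le_of_lt (Finset.card_le_card hDC) hCN) hD huD hpeD
        (fun e he => (hpb e (by simp [he])).anti (gA_mono G hDC)) (by linarith)
    obtain ⟨wB, hs, hc, hle, -⟩ := IH B u (lt_of_le_of_lt (Finset.card_le_card hBC) hCN) huB hB m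
      (by linarith)
    have hw1 : wsize (false :: w) = n0 + nE G D + 1 := by
      simp only [wsize, if_false, Bool.false_eq_true]; rw [hws]; ring
    obtain ⟨w', hs', hc', hle'⟩ := wmerge m (false :: w) wB (by rw [hw1, hs]; linarith)
    rw [hw1, hs] at hle' hs'
    have hX : 0 ≤ m - (n0 + nE G D + 1) - nE G B := by linarith
    have h1 := mul_nonneg (mul_nonneg hb hX) (show 0 ≤ n0 + nE G D + 1 - 3 by linarith)
    have hv1 : wval m (false :: w) = wval m w + (n0 + nE G D) * (m - 1 - (n0 + nE G D)) := by
      simp only [wval, if_false, Bool.false_eq_true]; rw [hws]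
    rw [hv1] at hle'
    -- distances
    have hadj1 := dist_adj_le hadj
    have hdx : (G.dist x u' : ℤ) ≤ p.length := by
      have := SimpleGraph.dist_le p.reverse
      rw [SimpleGraph.Walk.length_reverse] at this
      exact_mod_cast this
    have hdx2 : (G.dist x u : ℤ) ≤ p.length + 1 := by
      have := SimpleGraph.dist_le (SimpleGraph.Walk.cons hadj p).reverse
      rw [SimpleGraph.Walk.length_reverse, SimpleGraph.Walk.length_cons] at this
      exact_mod_cast this
    have hH : sH G (eA G C) = sH G (eA G B) + sH G (eA G D) + 2 * sX G (eA G B) (eA G D)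
        + 2 * (sX G {s(u, u')} (eA G B) + sX G {s(u, u')} (eA G D)) := by
      rw [heq, sH_insert hnot, sH_union hedis, sX_union_right hedis]
    have b1 := sX_le hG hadj1 (eA G B) (eA G D)
    have b2 := sX_one_le (G := G) (e := s(u, u')) (r := u) (by simp) (eA G B)
    have b3 := sX_one_le (G := G) (e := s(u, u')) (r := u') (by simp) (eA G D)
    have hDu : sD G u (eA G C) = sD G u (eA G B) + sD G u (eA G D) := by
      rw [heq, sD_insert hnot, sD_union hedis, vDist_of_mem G (by simp)]; simp
    have b4 := sD_le hG hadj1 (eA G D)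
    have hDx : sD G x (eA G C) = vDist G x s(u, u') + (sD G x (eA G B) + sD G x (eA G D)) := by
      rw [heq, sD_insert hnot, sD_union hedis]
    have b5 := sD_le hG hdx2 (eA G B)
    have b6 : (vDist G x s(u, u') : ℤ) ≤ p.length := by
      have := vDist_le G (v := x) (f := s(u, u')) (w := u') (by simp)
      zify at this; linarith
    change sX G (eA G B) (eA G D) ≤ nE G D * sD G u (eA G B) + nE G B * sD G u' (eA G D)
      + 1 * nE G B * nE G D at b1
    change _ ≤ sD G u' (eA G D) + 1 * nE G D at b4
    change _ ≤ sD G u (eA G B) + (p.length + 1) * nE G B at b5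
    have b7 := mul_le_mul_of_nonneg_left hDb hb
    have hlen : ((SimpleGraph.Walk.cons hadj p).length : ℤ) = p.length + 1 := by simp
    rw [hlen]
    have hl0 : (0 : ℤ) ≤ p.length := by positivity
    generalize (p.length : ℤ) = l at *
    generalize hDB : sD G u (eA G B) = DB at *
    obtain ⟨WB, hWB⟩ : ∃ WB, WB = wval m wB - (m - nE G B) * DB := ⟨_, rfl⟩
    have hb2 : sH G (eA G B) ≤ 2 * WB := by rw [hWB]; linarith
    generalize nE G B = b at *
    generalize nE G C = σ' at *
    subst hnE
    generalize nE G D = σ at *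
    subst hA
    refine ⟨Db + (A + l) + DB, Wb + Db + WB + (A + l + 1) * DB + b * (Db + (A + l)),
      Pb + l + DB + (l + 1) * b, A + b, S + A, w', ?_, ?_, ?_, ?_, ?_, ?_, ?_, ?_, ?_, ?_⟩
    · rw [hH]; clear * - b1 b2 b3 b7 hb2 hW hDb
      linarith
    · rw [hDu]; clear * - b4 hDb; linarith
    · rw [hDx]; clear * - b5 b6 hPb; linarith
    · ring
    · clear * - hdiff; linarith
    · exact add_nonneg hA0 hb
    · have := mul_nonneg hl0 hb
      clear * - this hS hb
      linarith
    · rw [hs']; ring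
    · rw [hc', hc, hcard]; simp only [wcnt, if_false, Bool.false_eq_true]; rw [hwc]
      push_cast; ring
    · exact pb_num m n0 b Db Wb DB WB S A l _ _ _ _ hwv hWB hle' h1 (mul_nonneg hA0 hb)
end main
section main2
variable {V : Type*} [Fintype V] {G : SimpleGraph V}

lemma nE_pos {A : Finset V} {r z : V} (hr : r ∈ A) (hz : z ∈ A) (hrz : z ≠ r) (hA : cA G A) :
    1 ≤ nE G A := by
  rcases Nat.eq_zero_or_pos (eA G A).card with h | h
  · have := eq_singleton_of_eA hr hA h
    rw [this] at hz
    simp at hz; exact absurd hz hrz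
  · unfold nE; exact_mod_cast h

lemma case_cut (hG : G.Connected) {C : Finset V} {r : V} (hr : r ∉ C) (hA : cA G (insert r C))
    (hC : ¬ cA G C)
    (IH : ∀ (B : Finset V) (x : V), B.card < (insert r C).card → x ∈ B → cA G B → MB G x B) :
    MB G r (insert r C) := by
  intro m hm
  obtain ⟨B, D, hBn, hDn, hdis, hun, hB, hD, heq, hedis, -⟩ := vertex_split hr hA hC
  have hBC : B ⊆ C := hun ▸ Finset.subset_union_left
  have hDC : D ⊆ C := hun ▸ Finset.subset_union_right
  have hrB : r ∉ B := fun h => hr (hBC h)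
  have hrD : r ∉ D := fun h => hr (hDC h)
  have hcard : C.card = B.card + D.card := by rw [← hun, Finset.card_union_of_disjoint hdis]
  have hBp := hBn.card_pos
  have hDp := hDn.card_pos
  have cB := Finset.card_insert_of_notMem hrB
  have cD := Finset.card_insert_of_notMem hrD
  have cC := Finset.card_insert_of_notMem hr
  have hnE : nE G (insert r C) = nE G (insert r B) + nE G (insert r D) := by
    unfold nE
    rw [heq, Finset.card_union_of_disjoint hedis]
    push_cast; ring
  obtain ⟨zB, hzB⟩ := hBn
  obtain ⟨zD, hzD⟩ := hDn
  have ha : 1 ≤ nE G (insert r B) := nE_pos (r := r) (z := zB) (by simp) (by simp [hzB])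
    (fun h => hrB (h ▸ hzB)) hB
  have hb : 1 ≤ nE G (insert r D) := nE_pos (r := r) (z := zD) (by simp) (by simp [hzD])
    (fun h => hrD (h ▸ hzD)) hD
  obtain ⟨w1, s1, c1, l1, -⟩ := IH (insert r B) r (by omega) (by simp) hB m (by linarith)
  obtain ⟨w2, s2, c2, l2, -⟩ := IH (insert r D) r (by omega) (by simp) hD m (by linarith)
  obtain ⟨w, s, c, l⟩ := wmerge m w1 w2 (by rw [s1, s2]; linarith)
  have hX := sX_le hG (r := r) (r' := r) (δ := 0) (by simp) (eA G (insert r B)) (eA G (insert r D))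
  change _ ≤ nE G (insert r D) * _ + nE G (insert r B) * _ + _ at hX
  have hH : sH G (eA G (insert r C)) = sH G (eA G (insert r B)) + sH G (eA G (insert r D))
      + 2 * sX G (eA G (insert r B)) (eA G (insert r D)) := by rw [heq, sH_union hedis]
  have hDD : sD G r (eA G (insert r C)) = sD G r (eA G (insert r B))
      + sD G r (eA G (insert r D)) := by rw [heq, sD_union hedis]
  rw [s1, s2] at s l
  have hlt : sH G (eA G (insert r C)) + 2 * (m - nE G (insert r C)) * sD G r (eA G (insert r C))
      < 2 * wval m w := by
    rw [hH, hDD, hnE]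
    rw [hnE] at hm
    have hp : 0 < nE G (insert r B) * nE G (insert r D) * (m - nE G (insert r B)
      - nE G (insert r D)) := by
      apply mul_pos (mul_pos _ _) _ <;> linarith
    clear * - hp l l1 l2 hX
    linarith
  refine ⟨w, by rw [s, hnE], ?_, hlt.le, fun h => absurd h hlt.ne⟩
  rw [c, c1, c2, hnE, cB, cD, cC, hcard]; push_cast; ring

lemma case_bridge (hG : G.Connected) {C : Finset V} {r u : V} (hr : r ∉ C) (hu : u ∈ C)
    (hru : G.Adj r u) (hno : ∀ v ∈ C, G.Adj r v → v = u) (IH : MB G u C) :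
    MB G r (insert r C) := by
  intro m hm
  have heq := eA_insert_one hr hu hru hno
  have hnot : s(r, u) ∉ eA G C := notMem_eA_left hr
  have hnE : nE G (insert r C) = nE G C + 1 := by
    unfold nE
    rw [heq, Finset.card_insert_of_notMem hnot]; push_cast; ring
  obtain ⟨w, s, c, l, e⟩ := IH m (by linarith)
  have cC := Finset.card_insert_of_notMem hr
  have hH : sH G (eA G (insert r C)) = sH G (eA G C) + 2 * sX G {s(r, u)} (eA G C) := by
    rw [heq, sH_insert hnot]
  have hDD : sD G r (eA G (insert r C)) = (vDist G r s(r, u) : ℤ) + sD G r (eA G C) := by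
    rw [heq, sD_insert hnot]
  have b1 := sX_one_le (G := G) (e := s(r, u)) (r := u) (by simp) (eA G C)
  have b2 := sD_le hG (dist_adj_le hru) (eA G C)
  change _ ≤ sD G u (eA G C) + 1 * nE G C at b2
  rw [vDist_of_mem G (by simp)] at hDD
  have hv : wval m (false :: w) = wval m w + nE G C * (m - 1 - nE G C) := by
    simp only [wval, if_false, Bool.false_eq_true]; rw [s]
  rw [hnE] at hm
  have b3 := mul_le_mul_of_nonneg_left b2 (show 0 ≤ m - (nE G C + 1) by linarith)
  refine ⟨false :: w, ?_, ?_, ?_, ?_⟩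
  · simp only [wsize, if_false, Bool.false_eq_true]; rw [s, hnE]; ring
  · simp only [wcnt, if_false, Bool.false_eq_true]; rw [c, hnE, cC]; push_cast; ring
  · rw [hv, hH, hDD, hnE]
    clear * - l b1 b3
    push_cast
    linarith
  · rw [hv, hH, hDD, hnE]
    intro h
    refine Lin.bridge (e (le_antisymm l ?_)) hr hru hno
    push_cast at h
    clear * - h b1 b3
    linarith

lemma case_tri (hG : G.Connected) {C B D : Finset V} {r u1 u2 : V} (hr : r ∉ C)
    (hr1 : G.Adj r u1) (hr2 : G.Adj r u2) (h12 : G.Adj u1 u2)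
    (hno : ∀ v ∈ C, G.Adj r v → v = u1 ∨ v = u2)
    (h1B : u1 ∈ B) (h2D : u2 ∈ D) (hdis : Disjoint B D) (hun : B ∪ D = C) (hB : cA G B)
    (hD : cA G D) (heq : eA G C = insert s(u1, u2) (eA G B ∪ eA G D))
    (hnot : s(u1, u2) ∉ eA G B ∪ eA G D) (hedis : Disjoint (eA G B) (eA G D))
    (hcross : ∀ a ∈ B, ∀ b ∈ D, G.Adj a b → a = u1 ∧ b = u2)
    (IHB : MB G u1 B) (IHD : MB G u2 D) :
    MB G r (insert r C) := by
  intro m hm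
  have hBC : B ⊆ C := hun ▸ Finset.subset_union_left
  have hDC : D ⊆ C := hun ▸ Finset.subset_union_right
  have hcard : C.card = B.card + D.card := by rw [← hun, Finset.card_union_of_disjoint hdis]
  have cC := Finset.card_insert_of_notMem hr
  have heqA := eA_insert_two hr (hBC h1B) hr1 (hDC h2D) hr2 hno
  have hn2 : s(r, u2) ∉ eA G C := notMem_eA_left hr
  have hn1 : s(r, u1) ∉ insert s(r, u2) (eA G C) := by
    rw [Finset.mem_insert, not_or]
    refine ⟨?_, notMem_eA_left hr⟩
    rw [Sym2.eq_iff]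
    have := h12.ne
    have := hr2.ne
    grind
  have hnE : nE G (insert r C) = nE G B + nE G D + 3 := by
    unfold nE
    rw [heqA, Finset.card_insert_of_notMem hn1, Finset.card_insert_of_notMem hn2, heq,
      Finset.card_insert_of_notMem hnot, Finset.card_union_of_disjoint hedis]
    push_cast; ring
  have hH : sH G (eA G (insert r C)) = sH G (eA G B) + sH G (eA G D)
      + 2 * sX G (eA G B) (eA G D)
      + 2 * (sX G {s(u1, u2)} (eA G B) + sX G {s(u1, u2)} (eA G D))
      + 2 * (hd G s(r, u2) s(u1, u2) + (sX G {s(r, u2)} (eA G B) + sX G {s(r, u2)} (eA G D)))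
      + 2 * (hd G s(r, u1) s(r, u2) + (hd G s(r, u1) s(u1, u2)
        + (sX G {s(r, u1)} (eA G B) + sX G {s(r, u1)} (eA G D)))) := by
    rw [heqA, sH_insert hn1, sH_insert hn2, sX_insert_right hn2, heq, sH_insert hnot,
      sX_insert_right hnot, sX_insert_right hnot, sH_union hedis, sX_union_right hedis,
      sX_union_right hedis, sX_union_right hedis]
  have hDD : sD G r (eA G (insert r C)) = vDist G r s(u1, u2)
      + (sD G r (eA G B) + sD G r (eA G D)) := by
    rw [heqA, sD_insert hn1, sD_insert hn2, heq, sD_insert hnot, sD_union hedis,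
      vDist_of_mem G (r := r) (e := s(r, u1)) (by simp),
      vDist_of_mem G (r := r) (e := s(r, u2)) (by simp)]
    simp
  have e1 : hd G s(r, u2) s(u1, u2) = 0 := by
    have := hd_le G (e := s(r, u2)) (f := s(u1, u2)) (u := u2) (w := u2) (by simp) (by simp)
    simpa using this
  have e2 : hd G s(r, u1) s(r, u2) = 0 := by
    have := hd_le G (e := s(r, u1)) (f := s(r, u2)) (u := r) (w := r) (by simp) (by simp)
    simpa using this
  have e3 : hd G s(r, u1) s(u1, u2) = 0 := by
    have := hd_le G (e := s(r, u1)) (f := s(u1, u2)) (u := u1) (w := u1) (by simp) (by simp)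
    simpa using this
  have e4 : (vDist G r s(u1, u2) : ℤ) ≤ 1 := by
    have h := vDist_le G (v := r) (f := s(u1, u2)) (w := u1) (by simp)
    have := dist_adj_le hr1
    zify at h; linarith
  rw [e1, e2, e3] at hH
  have b1 := sX_le hG (dist_adj_le h12) (eA G B) (eA G D)
  have b2 := sX_one_le (G := G) (e := s(u1, u2)) (r := u1) (by simp) (eA G B)
  have b3 := sX_one_le (G := G) (e := s(u1, u2)) (r := u2) (by simp) (eA G D)
  have b4 := sX_one_le' hG (e := s(r, u2)) (r := r) (by simp) (dist_adj_le hr1) (eA G B)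
  have b5 := sX_one_le (G := G) (e := s(r, u2)) (r := u2) (by simp) (eA G D)
  have b6 := sX_one_le (G := G) (e := s(r, u1)) (r := u1) (by simp) (eA G B)
  have b7 := sX_one_le' hG (e := s(r, u1)) (r := r) (by simp) (dist_adj_le hr2) (eA G D)
  have b8 := sD_le hG (dist_adj_le hr1) (eA G B)
  have b9 := sD_le hG (dist_adj_le hr2) (eA G D)
  change _ ≤ nE G D * _ + nE G B * _ + 1 * nE G B * nE G D at b1
  change _ ≤ _ + 1 * nE G B at b4
  change _ ≤ _ + 1 * nE G D at b7
  change _ ≤ _ + 1 * nE G B at b8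
  change _ ≤ _ + 1 * nE G D at b9
  have ha := nE_nonneg (G := G) B
  have hb := nE_nonneg (G := G) D
  rw [hnE] at hm
  obtain ⟨w1, s1, c1, l1, q1⟩ := IHB m (by linarith)
  obtain ⟨w2, s2, c2, l2, q2⟩ := IHD m (by linarith)
  have hc : 0 < m - (nE G B + nE G D + 3) := by linarith
  have hDle : sD G r (eA G (insert r C)) ≤ sD G u1 (eA G B) + sD G u2 (eA G D)
      + nE G B + nE G D + 1 := by rw [hDD]; linarith
  have hHle : sH G (eA G (insert r C)) ≤ sH G (eA G B) + sH G (eA G D)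
      + 2 * (nE G D * sD G u1 (eA G B) + nE G B * sD G u2 (eA G D) + nE G B * nE G D)
      + 2 * (3 * sD G u1 (eA G B) + 3 * sD G u2 (eA G D) + nE G B + nE G D) := by
    rw [hH]; push_cast; linarith
  have hcD := mul_le_mul_of_nonneg_left hDle hc.le
  have hsum : sH G (eA G (insert r C)) + 2 * (m - nE G (insert r C)) * sD G r (eA G (insert r C))
      ≤ (sH G (eA G B) + 2 * (m - nE G B) * sD G u1 (eA G B))
      + (sH G (eA G D) + 2 * (m - nE G D) * sD G u2 (eA G D))
      + 2 * (nE G B * nE G D + (nE G B + nE G D) * (1 + (m - (nE G B + nE G D + 3)))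
        + (m - (nE G B + nE G D + 3))) := by
    rw [hnE]
    clear * - hHle hcD
    linarith
  have hvt : ∀ w, wval m (true :: w) = wval m w + wsize w * (m - 3 - wsize w) + (m - 3) := by
    intro w; simp only [wval, if_true]; ring
  have hst : ∀ w, wsize (true :: w) = 3 + wsize w := by
    intro w; simp only [wsize, if_true]
  have hct : ∀ w, wcnt (true :: w) = 1 + wcnt w := by
    intro w; simp only [wcnt, if_true]
  by_cases hb0 : nE G D = 0
  · have hDs : D = {u2} := eq_singleton_of_eA h2D hD (by unfold nE at hb0; exact_mod_cast hb0)
    have z1 : sH G (eA G D) = 0 := by rw [hDs, eA_singleton, sH_empty]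
    have z2 : sD G u2 (eA G D) = 0 := by rw [hDs, eA_singleton, sD_empty]
    rw [z1, z2, hb0] at hsum
    refine ⟨true :: w1, ?_, ?_, ?_, ?_⟩
    · rw [hst, s1, hnE, hb0]; ring
    · rw [hct, c1, hnE, hb0, cC, hcard, hDs]; simp; ring
    · rw [hvt, s1]
      clear * - hsum l1
      linarith
    · rw [hvt, s1]
      intro h
      have hu2 : u2 ∉ B := fun h => Finset.disjoint_left.1 hdis h h2D
      have := Lin.tri (q1 (le_antisymm l1 (by clear * - hsum l1 h; linarith)))
        (fun h => hr (hBC h)) hu2 hr2 hr1 h12.symm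
        (fun v hv hrv => (hno v (hBC hv) hrv).resolve_right (fun h => hu2 (h ▸ hv)))
        (fun v hv hrv => (hcross v hv u2 h2D hrv.symm).1)
      have hCe : C = insert u2 B := by rw [← hun, hDs, Finset.union_comm]; rfl
      rw [hCe]; exact this
  by_cases ha0 : nE G B = 0
  · have hBs : B = {u1} := eq_singleton_of_eA h1B hB (by unfold nE at ha0; exact_mod_cast ha0)
    have z1 : sH G (eA G B) = 0 := by rw [hBs, eA_singleton, sH_empty]
    have z2 : sD G u1 (eA G B) = 0 := by rw [hBs, eA_singleton, sD_empty]
    rw [z1, z2, ha0] at hsum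
    refine ⟨true :: w2, ?_, ?_, ?_, ?_⟩
    · rw [hst, s2, hnE, ha0]; ring
    · rw [hct, c2, hnE, ha0, cC, hcard, hBs]; simp; ring
    · rw [hvt, s2]
      clear * - hsum l2
      linarith
    · rw [hvt, s2]
      intro h
      have hu1 : u1 ∉ D := fun h => Finset.disjoint_left.1 hdis h1B h
      have := Lin.tri (q2 (le_antisymm l2 (by clear * - hsum l2 h; linarith)))
        (fun h => hr (hDC h)) hu1 hr1 hr2 h12
        (fun v hv hrv => (hno v (hDC hv) hrv).resolve_left (fun h => hu1 (h ▸ hv)))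
        (fun v hv hrv => (hcross u1 h1B v hv hrv).2)
      have hCe : C = insert u1 D := by rw [← hun, hBs]; rfl
      rw [hCe]; exact this
  have ha1 : 0 < nE G B := lt_of_le_of_ne ha (Ne.symm ha0)
  have hb1 : 0 < nE G D := lt_of_le_of_ne hb (Ne.symm hb0)
  obtain ⟨w, s, c, l⟩ := wmerge m w1 w2 (by rw [s1, s2]; linarith)
  rw [s1, s2] at s l
  have hp := mul_pos (mul_pos ha1 hb1) hc
  have hlt : sH G (eA G (insert r C)) + 2 * (m - nE G (insert r C)) * sD G r (eA G (insert r C))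
      < 2 * wval m (true :: w) := by
    rw [hvt, s]
    clear * - hp l l1 l2 hsum
    linarith
  refine ⟨true :: w, by rw [hst, s, hnE]; ring, ?_, hlt.le, fun h => absurd h hlt.ne⟩
  rw [hct, c, c1, c2, hnE, cC, hcard]; push_cast; ring

lemma long_num (m a A l S c Db Wb P Da Ha H DR v1 v0 v : ℤ) (hm : m = a + 3 + (A + l) + c)
    (hc : 1 ≤ c) (hl : 1 ≤ l) (ha : 0 ≤ a) (hS : S ≤ l * A) (hP : Db - P = 2 * S - l * A)
    (hH : H ≤ 2 * Wb + Ha + 2 * (Da * (A + l + 3) + P * (a + 2) + Db + a * (A + l) + a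
      + (A + l) + 1))
    (hD : DR ≤ Da + a + Db + (A + l) + 1) (h1 : Ha + 2 * (m - a) * Da ≤ 2 * v1)
    (h2 : (m - 3) + v1 + a * (m - 3 - a) ≤ v0)
    (h3 : v0 + Wb + (m - (A + l)) * Db + (a + 3) * (l * (m - (a + 3) - 1) - 2 * S - l * (l - 1)) +
      A * (m - (a + 3) - A - l) + S ≤ v) :
    H + 2 * c * DR < 2 * v := by
  subst hm
  obtain rfl : P = Db - (2 * S - l * A) := by linarith
  have p1 := mul_le_mul_of_nonneg_left hD (show 0 ≤ c by linarith)
  have p2 : 1 ≤ l * c := by nlinarith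
  have p3 := mul_nonneg ha (show 0 ≤ l * c by linarith)
  linarith

lemma case_long (hG : G.Connected) {C B D : Finset V} {r u1 u2 y : V} (hr : r ∉ C)
    (hr1 : G.Adj r u1) (hr2 : G.Adj r u2) (h12 : u1 ≠ u2) (h1y : G.Adj u1 y)
    (hno : ∀ v ∈ C, G.Adj r v → v = u1 ∨ v = u2)
    (h1B : u1 ∈ B) (h2D : u2 ∈ D) (hdis : Disjoint B D) (hun : B ∪ D = C) (hB : cA G B)
    (hD : cA G D) (heq : eA G C = insert s(u1, y) (eA G B ∪ eA G D))
    (hnot : s(u1, y) ∉ eA G B ∪ eA G D) (hedis : Disjoint (eA G B) (eA G D))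
    (p : G.Walk u2 y) (hp : p.IsPath) (hpl : 1 ≤ p.length) (hpe : ∀ e ∈ p.edges, e ∈ eA G D)
    (hpb : ∀ e ∈ p.edges, (gA G D).IsBridge e)
    (IH : ∀ (B : Finset V) (x : V), B.card < (insert r C).card → x ∈ B → cA G B → MB G x B) :
    MB G r (insert r C) := by
  intro m hm
  have hBC : B ⊆ C := hun ▸ Finset.subset_union_left
  have hDC : D ⊆ C := hun ▸ Finset.subset_union_right
  have hcard : C.card = B.card + D.card := by rw [← hun, Finset.card_union_of_disjoint hdis]
  have cC := Finset.card_insert_of_notMem hr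
  have heqA := eA_insert_two hr (hBC h1B) hr1 (hDC h2D) hr2 hno
  have hn2 : s(r, u2) ∉ eA G C := notMem_eA_left hr
  have hn1 : s(r, u1) ∉ insert s(r, u2) (eA G C) := by
    rw [Finset.mem_insert, not_or]
    refine ⟨?_, notMem_eA_left hr⟩
    rw [Sym2.eq_iff]
    have := hr2.ne
    grind
  have hnE : nE G (insert r C) = nE G B + nE G D + 3 := by
    unfold nE
    rw [heqA, Finset.card_insert_of_notMem hn1, Finset.card_insert_of_notMem hn2, heq,
      Finset.card_insert_of_notMem hnot, Finset.card_union_of_disjoint hedis]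
    push_cast; ring
  have hH : sH G (eA G (insert r C)) = sH G (eA G B) + sH G (eA G D)
      + 2 * sX G (eA G B) (eA G D)
      + 2 * (sX G {s(u1, y)} (eA G B) + sX G {s(u1, y)} (eA G D))
      + 2 * (hd G s(r, u2) s(u1, y) + (sX G {s(r, u2)} (eA G B) + sX G {s(r, u2)} (eA G D)))
      + 2 * (hd G s(r, u1) s(r, u2) + (hd G s(r, u1) s(u1, y)
        + (sX G {s(r, u1)} (eA G B) + sX G {s(r, u1)} (eA G D)))) := by
    rw [heqA, sH_insert hn1, sH_insert hn2, sX_insert_right hn2, heq, sH_insert hnot,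
      sX_insert_right hnot, sX_insert_right hnot, sH_union hedis, sX_union_right hedis,
      sX_union_right hedis, sX_union_right hedis]
  have hDD : sD G r (eA G (insert r C)) = vDist G r s(u1, y)
      + (sD G r (eA G B) + sD G r (eA G D)) := by
    rw [heqA, sD_insert hn1, sD_insert hn2, heq, sD_insert hnot, sD_union hedis,
      vDist_of_mem G (r := r) (e := s(r, u1)) (by simp),
      vDist_of_mem G (r := r) (e := s(r, u2)) (by simp)]
    simp
  have e2 : hd G s(r, u1) s(r, u2) = 0 := by
    have := hd_le G (e := s(r, u1)) (f := s(r, u2)) (u := r) (w := r) (by simp) (by simp)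
    simpa using this
  have e3 : hd G s(r, u1) s(u1, y) = 0 := by
    have := hd_le G (e := s(r, u1)) (f := s(u1, y)) (u := u1) (w := u1) (by simp) (by simp)
    simpa using this
  have e4 : (vDist G r s(u1, y) : ℤ) ≤ 1 := by
    have h := vDist_le G (v := r) (f := s(u1, y)) (w := u1) (by simp)
    have := dist_adj_le hr1
    zify at h; linarith
  have e1 : (hd G s(r, u2) s(u1, y) : ℤ) ≤ 1 := by
    have h := hd_le_of_mem G (r := r) (e := s(r, u2)) (f := s(u1, y)) (by simp)
    zify at h; linarith
  rw [e2, e3] at hH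
  have b1 := sX_le hG (dist_adj_le h1y) (eA G B) (eA G D)
  have b2 := sX_one_le (G := G) (e := s(u1, y)) (r := u1) (by simp) (eA G B)
  have b3 := sX_one_le (G := G) (e := s(u1, y)) (r := y) (by simp) (eA G D)
  have b4 := sX_one_le' hG (e := s(r, u2)) (r := r) (by simp) (dist_adj_le hr1) (eA G B)
  have b5 := sX_one_le (G := G) (e := s(r, u2)) (r := u2) (by simp) (eA G D)
  have b6 := sX_one_le (G := G) (e := s(r, u1)) (r := u1) (by simp) (eA G B)
  have b7 := sX_one_le' hG (e := s(r, u1)) (r := u1) (by simp) (dist_adj_le h1y) (eA G D)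
  have b8 := sD_le hG (dist_adj_le hr1) (eA G B)
  have b9 := sD_le hG (dist_adj_le hr2) (eA G D)
  change _ ≤ nE G D * _ + nE G B * _ + 1 * nE G B * nE G D at b1
  change _ ≤ _ + 1 * nE G B at b4
  change _ ≤ _ + 1 * nE G D at b7
  change _ ≤ _ + 1 * nE G B at b8
  change _ ≤ _ + 1 * nE G D at b9
  have ha := nE_nonneg (G := G) B
  have hb := nE_nonneg (G := G) D
  rw [hnE] at hm
  have cB := Finset.card_le_card hBC
  have cD := Finset.card_le_card hDC
  obtain ⟨w1, s1, c1, l1, -⟩ := IH B u1 (by omega) h1B hB m (by linarith)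
  have st : wsize [true] = 3 := by simp [wsize]
  obtain ⟨w0, s0, c0, l0⟩ := wmerge m [true] w1 (by rw [st, s1]; linarith)
  rw [st, s1] at s0 l0
  have vt : wval m [true] = m - 3 := by simp [wval, wsize]
  have ct : wcnt [true] = 1 := by simp [wcnt]
  rw [vt] at l0
  obtain ⟨Db, Wb, Pb, A, S, w, hW, hDb, hPb, hA, hdiff, hA0, hS, hws, hwc, hwv⟩ :=
    path_bound hG _ IH m (nE G B + 3) (by linarith) w0 (by rw [s0]; ring) p hp D (by omega) hD h2D
      hpe hpb (by linarith)
  have hPa := mul_le_mul_of_nonneg_left hPb ha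
  have hlt : sH G (eA G (insert r C)) + 2 * (m - nE G (insert r C)) * sD G r (eA G (insert r C))
      < 2 * wval m w := by
    refine long_num m (nE G B) A p.length S (m - nE G (insert r C)) Db Wb Pb
      (sD G u1 (eA G B)) (sH G (eA G B)) _ _ (wval m w1) (wval m w0) _ ?_ ?_ ?_ ha hS hdiff
      ?_ ?_ l1 ?_ ?_
    · rw [hnE, hA]; ring
    · rw [hnE]; linarith
    · exact_mod_cast hpl
    · rw [hH, ← hA]
      clear * - b1 b2 b3 b4 b5 b6 b7 e1 hW hDb hPb hPa
      push_cast
      linarith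
    · rw [hDD, ← hA]
      clear * - b8 b9 e4 hDb
      linarith
    · clear * - l0
      linarith
    · rw [← hA]; exact hwv
  refine ⟨w, by rw [hws, hnE]; ring, ?_, hlt.le, fun h => absurd h hlt.ne⟩
  rw [hwc, c0, ct, c1, hnE, cC, hcard]; push_cast; ring

theorem main_bound (hG : IsCactus G) : ∀ (N : ℕ) (A : Finset V) (r : V), A.card = N → r ∈ A →
    cA G A → MB G r A := by
  intro N
  induction N using Nat.strong_induction_on with
  | _ N ih =>
  intro A r hN hr hA
  subst hN
  have IH : ∀ (B : Finset V) (x : V), B.card < A.card → x ∈ B → cA G B → MB G x B :=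
    fun B x hB hx hc => ih B.card hB B x rfl hx hc
  obtain ⟨C, hrC, rfl⟩ : ∃ C : Finset V, r ∉ C ∧ insert r C = A :=
    ⟨A.erase r, by simp, Finset.insert_erase hr⟩
  by_cases hC : cA G C
  swap
  · exact case_cut hG.1 hrC hA hC IH
  have cC := Finset.card_insert_of_notMem hrC
  rcases C.eq_empty_or_nonempty with rfl | ⟨z, hz⟩
  · have e1 : (insert r ∅ : Finset V) = {r} := rfl
    rw [e1]
    intro m hm
    have e2 : nE G ({r} : Finset V) = 0 := by unfold nE; rw [eA_singleton]; simp
    refine ⟨[], ?_, ?_, ?_, fun _ => Lin.nil r⟩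
    · rw [e2]; simp [wsize]
    · rw [e2]; simp [wcnt]
    · rw [e2, eA_singleton, sH_empty, sD_empty]; simp [wval]
  obtain ⟨u1, h1, hr1, -⟩ := exists_nbr hA hz hrC
  by_cases hone : ∀ v ∈ C, G.Adj r v → v = u1
  · exact case_bridge hG.1 hrC h1 hr1 hone (IH C u1 (by omega) h1 hC)
  push Not at hone
  obtain ⟨u2, h2, hr2, h21⟩ := hone
  obtain ⟨hno, p, hp, hpe, hps, hpb⟩ := two_nbrs hG hC hrC h1 h2 h21.symm hr1 hr2
  cases p with
  | nil => exact absurd rfl h21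
  | cons h1y p =>
    rename_i y
    rw [SimpleGraph.Walk.cons_isPath_iff] at hp
    have hy : y ∈ C := hps y (by simp)
    obtain ⟨B, D, huB, huD, hdis, hun, hB, hD, heq, hnot, hedis, hcross, hwalk⟩ :=
      bridge_split hC h1y h1 hy (hpb _ (by simp))
    have hBC : B ⊆ C := hun ▸ Finset.subset_union_left
    have hDC : D ⊆ C := hun ▸ Finset.subset_union_right
    have cB := Finset.card_le_card hBC
    have cD := Finset.card_le_card hDC
    have hpsup := hwalk u2 p (fun e he => hpe e (by simp [he])) (fun h =>
      hp.2 (SimpleGraph.Walk.fst_mem_support_of_mem_edges _ h))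
    have hpeD : ∀ e ∈ p.edges, e ∈ eA G D := by
      intro e he
      induction e with | _ a b =>
      have h1 := hpe s(a, b) (by simp [he])
      rw [mem_eA] at h1 ⊢
      exact ⟨h1.1, hpsup _ (SimpleGraph.Walk.fst_mem_support_of_mem_edges _ he),
        hpsup _ (SimpleGraph.Walk.snd_mem_support_of_mem_edges _ he)⟩
    have h2D : u2 ∈ D := hpsup u2 p.end_mem_support
    rcases Nat.eq_zero_or_pos p.length with hl | hl
    · have hyu := SimpleGraph.Walk.eq_of_length_eq_zero hl
      subst hyu
      exact case_tri hG.1 hrC hr1 hr2 h1y hno huB huD hdis hun hB hD heq hnot hedis hcross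
        (IH B u1 (by omega) huB hB) (IH D _ (by omega) huD hD)
    · refine case_long hG.1 hrC hr1 hr2 h21.symm h1y hno huB h2D hdis hun hB hD heq hnot hedis
        p.reverse hp.1.reverse (by rw [SimpleGraph.Walk.length_reverse]; exact hl) ?_ ?_ IH
      · intro e he
        exact hpeD e (by simpa using he)
      · intro e he
        exact (hpb e (by simp at he; simp [he])).anti (gA_mono G hDC)

end main2
section top
variable {V : Type*} [Fintype V] {G : SimpleGraph V}

lemma exists_cut (hG : IsCactus G) (hcard : 3 ≤ Fintype.card V)
    (hm : G.edgeFinset.card ≠ Fintype.card V) : ∃ r : V, ¬ cA G (Finset.univ.erase r) := by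
  by_contra hcon
  push Not at hcon
  have hdeg : ∀ r, G.degree r = 2 := by
    intro r
    apply le_antisymm
    · by_contra hlt
      push Not at hlt
      rw [← SimpleGraph.card_neighborFinset_eq_degree, Finset.two_lt_card] at hlt
      obtain ⟨a, ha, b, hb, c, hc, hab, hac, hbc⟩ := hlt
      rw [SimpleGraph.mem_neighborFinset] at ha hb hc
      have := (two_nbrs hG (hcon r) (r := r) (u1 := a) (u2 := b) (by simp) (by simp [ha.ne'])
        (by simp [hb.ne']) hab ha hb).1 c (by simp [hc.ne']) hc
      grind
    · by_contra hlt
      push Not at hlt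
      have hex : ∃ u, u ≠ r ∧ ∀ v, G.Adj r v → v = u := by
        by_cases h0 : ∃ u, G.Adj r u
        · obtain ⟨u, hu⟩ := h0
          refine ⟨u, hu.ne', fun v hv => ?_⟩
          rw [← SimpleGraph.card_neighborFinset_eq_degree] at hlt
          exact Finset.card_le_one.1 (show (G.neighborFinset r).card ≤ 1 by omega) v (by simpa using hv) u (by simpa using hu)
        · push Not at h0
          obtain ⟨u, hu⟩ := Fintype.exists_ne_of_one_lt_card (by omega) r
          exact ⟨u, hu, fun v hv => absurd hv (h0 v)⟩
      obtain ⟨u, hur, hu⟩ := hex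
      obtain ⟨w, hw⟩ : ∃ w, w ∉ ({r, u} : Finset V) := by
        by_contra hall
        push Not at hall
        have h1 := Finset.card_le_card (show Finset.univ ⊆ ({r, u} : Finset V) from
          fun x _ => hall x)
        have h2 := Finset.card_le_two (a := r) (b := u)
        rw [Finset.card_univ] at h1
        omega
      simp only [Finset.mem_insert, Finset.mem_singleton, not_or] at hw
      have hre := hcon u r (by simp [hur.symm]) w (by simp [hw.2])
      refine hw.1 (reach_ind (P := fun z => z = r) rfl ?_ hre)
      intro a b _ hab har
      have har' : a = r := har
      rw [har'] at hab
      have := hu b hab.1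
      have := hab.2.2
      simp_all
  have := G.sum_degrees_eq_twice_card_edges
  simp only [hdeg, Finset.sum_const, Finset.card_univ, smul_eq_mul] at this
  apply hm
  convert (show G.edgeFinset.card = Fintype.card V by omega)

lemma Lin.mem {r : V} {A : Finset V} {w : List Bool} (h : Lin G r A w) : r ∈ A := by
  cases h <;> simp

lemma Lin.join {r : V} {A : Finset V} {w2 : List Bool} (h : Lin G r A w2) :
    ∀ (B : Finset V) (w1 : List Bool), Lin G r B w1 → (∀ x ∈ A, x ∈ B → x = r) →
    (∀ x ∈ A, ∀ y ∈ B, G.Adj x y → x = r ∨ y = r) →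
    ∃ r', Lin G r' (A ∪ B) (w2.reverseAux w1) := by
  induction h with
  | nil r =>
    intro B w1 hB _ _
    refine ⟨r, ?_⟩
    rw [Finset.union_eq_right.2 (by simpa using hB.mem)]
    exact hB
  | @bridge u r C w h hr hru hno ih =>
    intro B w1 hB hI hX
    have hrB := hB.mem
    have huC := h.mem
    have huB : u ∉ B := fun hh => hr (hI u (by simp [huC]) hh ▸ huC)
    have h1 : Lin G u (insert u B) (false :: w1) := by
      refine Lin.bridge hB huB hru.symm ?_
      intro v hv huv
      rcases hX u (by simp [huC]) v hv huv with h | h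
      · exact absurd (h ▸ huC) hr
      · exact h
    obtain ⟨r', hr'⟩ := ih (insert u B) (false :: w1) h1 (by grind) (by
      intro x hx y hy hxy
      have := hX x (by simp [hx]) y
      have := hno x hx
      have h3 := hxy.symm
      grind)
    refine ⟨r', ?_⟩
    have e : insert r C ∪ B = C ∪ insert u B := by ext x; grind
    rw [e]
    exact hr'
  | @tri u r z C w h hr hz hrz hru hzu hno hno' ih =>
    intro B w1 hB hI hX
    have hrB := hB.mem
    have huC := h.mem
    have huB : u ∉ B := fun hh => hr (hI u (by simp [huC]) hh ▸ huC)
    have hzB : z ∉ B := fun hh => hrz.ne (hI z (by simp) hh).symm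
    have h1 : Lin G u (insert u (insert z B)) (true :: w1) := by
      refine Lin.tri hB huB hzB hzu.symm hru.symm hrz.symm ?_ ?_
      · intro v hv huv
        rcases hX u (by simp [huC]) v hv huv with h | h
        · exact absurd (h ▸ huC) hr
        · exact h
      · intro v hv huv
        rcases hX z (by simp) v hv huv with h | h
        · exact absurd h hrz.ne'
        · exact h
    obtain ⟨r', hr'⟩ := ih (insert u (insert z B)) (true :: w1) h1 (by grind) (by
      intro x hx y hy hxy
      have := hX x (by simp [hx]) y
      have := hno x hx
      have := hno' x hx
      have h3 := hxy.symm
      grind)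
    refine ⟨r', ?_⟩
    have e : insert r (insert z C) ∪ B = C ∪ insert u (insert z B) := by ext x; grind
    rw [e]
    exact hr'

set_option maxHeartbeats 1000000 in
lemma top_bound (hG : IsCactus G) (k q : ℕ) (h5 : 5 ≤ Fintype.card V)
    (hcard : Fintype.card V = 4 * k + q + 1) (hm : G.edgeFinset.card = 6 * k + q) :
    sH G G.edgeFinset ≤ 2 * wval (6 * k + q) (extW k q) ∧
    (sH G G.edgeFinset = 2 * wval (6 * k + q) (extW k q) → ∃ r, Lin G r Finset.univ (extW k q)) := by
  obtain ⟨r, hr⟩ := exists_cut hG (by omega) (by omega)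
  have hu : insert r (Finset.univ.erase r) = (Finset.univ : Finset V) := by simp
  have hcu : cA G (insert r (Finset.univ.erase r)) := by
    rw [hu]
    intro x _ y _
    refine reach_ind (K := G) (P := fun z => (gA G Finset.univ).Reachable x z)
      (SimpleGraph.Reachable.refl _) ?_ (hG.1.preconnected x y)
    intro a b _ hab ih
    exact ih.trans (SimpleGraph.Adj.reachable ⟨hab, by simp, by simp⟩)
  obtain ⟨B, D, hBn, hDn, hdis, hun, hB, hD, heq, hedis, hcr⟩ := vertex_split (by simp) hcu hr
  rw [hu, eA_univ] at heq
  have hrB : r ∉ B := fun h => by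
    have : r ∈ Finset.univ.erase r := hun ▸ Finset.mem_union_left _ h
    simp at this
  have hrD : r ∉ D := fun h => by
    have : r ∈ Finset.univ.erase r := hun ▸ Finset.mem_union_right _ h
    simp at this
  have hcE : (Finset.univ.erase r).card = B.card + D.card := by
    rw [← hun, Finset.card_union_of_disjoint hdis]
  rw [Finset.card_erase_of_mem (by simp), Finset.card_univ, hcard] at hcE
  have cB := Finset.card_insert_of_notMem hrB
  have cD := Finset.card_insert_of_notMem hrD
  obtain ⟨zB, hzB⟩ := hBn
  obtain ⟨zD, hzD⟩ := hDn
  have ha : 1 ≤ nE G (insert r B) := nE_pos (r := r) (z := zB) (by simp) (by simp [hzB])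
    (fun h => hrB (h ▸ hzB)) hB
  have hb : 1 ≤ nE G (insert r D) := nE_pos (r := r) (z := zD) (by simp) (by simp [hzD])
    (fun h => hrD (h ▸ hzD)) hD
  have hnE : (6 * k + q : ℤ) = nE G (insert r B) + nE G (insert r D) := by
    have := hm
    rw [heq, Finset.card_union_of_disjoint hedis] at this
    unfold nE
    exact_mod_cast this.symm
  set m : ℤ := 6 * k + q with hmdef
  obtain ⟨w1, s1, c1, l1, q1⟩ := main_bound hG _ (insert r B) r rfl (by simp) hB m (by linarith)
  obtain ⟨w2, s2, c2, l2, q2⟩ := main_bound hG _ (insert r D) r rfl (by simp) hD m (by linarith)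
  have hX := sX_le hG.1 (r := r) (r' := r) (δ := 0) (by simp) (eA G (insert r B)) (eA G (insert r D))
  change _ ≤ nE G (insert r D) * _ + nE G (insert r B) * _ + _ at hX
  have hH : sH G G.edgeFinset = sH G (eA G (insert r B)) + sH G (eA G (insert r D))
      + 2 * sX G (eA G (insert r B)) (eA G (insert r D)) := by rw [heq, sH_union hedis]
  have hv := wval_reverseAux m w2 w1
  have hz : m - wsize w2 - wsize w1 = 0 := by rw [s1, s2]; linarith
  rw [hz, zero_mul, add_zero] at hv
  have hws : wsize (w2.reverseAux w1) = m := by rw [wsize_reverseAux]; linarith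
  have hwc : wcnt (w2.reverseAux w1) = 2 * k := by
    rw [wcnt_reverseAux, c1, c2, cB, cD]
    push_cast
    have : (B.card + D.card : ℤ) = 4 * k + q := by
      have : B.card + D.card = 4 * k + q := by omega
      exact_mod_cast this
    linarith
  obtain ⟨hmain, hmeq⟩ := wval_main m k q hmdef _ hws hwc
  have e1 : m - nE G (insert r B) = nE G (insert r D) := by linarith
  have e2 : m - nE G (insert r D) = nE G (insert r B) := by linarith
  rw [e1] at l1 q1
  rw [e2] at l2 q2
  have hle : sH G G.edgeFinset ≤ 2 * wval m (w2.reverseAux w1) := by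
    rw [hH, hv]; linarith
  refine ⟨hle.trans (by linarith), fun h => ?_⟩
  have h1 : wval m (w2.reverseAux w1) = wval m (extW k q) := by linarith
  have L1 := q1 (by linarith)
  have L2 := q2 (by linarith)
  obtain ⟨r', hr'⟩ := L2.join _ _ L1 (by
    intro x hx hx'
    rw [Finset.mem_insert] at hx hx'
    rcases hx with h | h
    · exact h
    rcases hx' with h' | h'
    · exact h'
    exact absurd h (Finset.disjoint_left.1 hdis h')) (by
    intro x hx y hy hxy
    rw [Finset.mem_insert] at hx hy
    rcases hx with h | h
    · exact Or.inl h
    rcases hy with h' | h'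
    · exact Or.inr h'
    exact absurd hxy.symm (hcr y h' x h))
  rw [hmeq h1] at hr'
  refine ⟨r', ?_⟩
  convert hr'
  ext x
  have : x = r ∨ x ∈ B ∪ D := by rw [hun]; simp [em]
  simp at this ⊢
  tauto

end top
section uniq

lemma Lin.mem' {V : Type*} {G : SimpleGraph V} {r : V} {A : Finset V} {w : List Bool}
    (h : Lin G r A w) : r ∈ A := by
  cases h <;> simp

lemma Lin.unique {V W : Type*} {G : SimpleGraph V} {H : SimpleGraph W} {r : V} {A : Finset V}
    {w : List Bool} (h : Lin G r A w) : ∀ {r' : W} {A' : Finset W}, Lin H r' A' w →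
    ∃ f : V → W, f r = r' ∧ (∀ x ∈ A, f x ∈ A') ∧ (∀ y ∈ A', ∃ x ∈ A, f x = y) ∧
      (∀ x ∈ A, ∀ y ∈ A, f x = f y → x = y) ∧
      (∀ x ∈ A, ∀ y ∈ A, (H.Adj (f x) (f y) ↔ G.Adj x y)) := by
  induction h with
  | nil r =>
    intro r' A' h'
    cases h'
    refine ⟨fun _ => r', rfl, ?_, ?_, ?_, ?_⟩ <;> simp
  | @bridge u r C w h hr hru hno ih =>
    intro r' A' h'
    cases h' with
    | @bridge u' _ C' _ h' hr' hru' hno' =>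
    obtain ⟨f, f1, f2, f3, f4, f5⟩ := ih h'
    have huC := h.mem'
    have huC' := h'.mem'
    have hne : ∀ x ∈ C, x ≠ r := fun x hx e => hr (e ▸ hx)
    have a1 : ∀ x ∈ C, (G.Adj r x ↔ x = u) := fun x hx =>
      ⟨hno x hx, fun e => e ▸ hru⟩
    have a2 : ∀ x ∈ C, (H.Adj r' (f x) ↔ x = u) := fun x hx =>
      ⟨fun hh => f4 x hx u huC (by rw [f1]; exact hno' _ (f2 x hx) hh), fun e => by
        rw [e, f1]; exact hru'⟩
    refine ⟨Function.update f r r', by simp, ?_, ?_, ?_, ?_⟩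
    · intro x hx
      simp only [Function.update_apply]
      grind
    · intro y hy
      simp only [Function.update_apply]
      rw [Finset.mem_insert] at hy
      rcases hy with rfl | hy
      · exact ⟨r, by simp, by simp⟩
      · obtain ⟨x, hx, hxy⟩ := f3 y hy
        exact ⟨x, by simp [hx], by rw [if_neg (hne x hx)]; exact hxy⟩
    · intro x hx y hy
      simp only [Function.update_apply]
      grind
    · intro x hx y hy
      rw [Finset.mem_insert] at hx hy
      simp only [Function.update_apply]
      rcases hx with rfl | hx <;> rcases hy with rfl | hy
      · simp
      · rw [if_pos rfl, if_neg (hne y hy), a1 y hy, a2 y hy]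
      · rw [if_pos rfl, if_neg (hne x hx), G.adj_comm, H.adj_comm, a1 x hx, a2 x hx]
      · rw [if_neg (hne y hy), if_neg (hne x hx)]
        exact f5 x hx y hy
  | @tri u r z C w h hr hz hrz hru hzu hno hnoz ih =>
    intro r' A' h'
    cases h' with
    | @tri u' _ z' C' _ h' hr' hz' hrz' hru' hzu' hno' hnoz' =>
    obtain ⟨f, f1, f2, f3, f4, f5⟩ := ih h'
    have huC := h.mem'
    have huC' := h'.mem'
    have hne : ∀ x ∈ C, x ≠ r := fun x hx e => hr (e ▸ hx)
    have hnez : ∀ x ∈ C, x ≠ z := fun x hx e => hz (e ▸ hx)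
    have hzr := hrz.ne'
    have hzr' := hrz'.ne'
    have a1 : ∀ x ∈ C, (G.Adj r x ↔ x = u) := fun x hx =>
      ⟨hno x hx, fun e => e ▸ hru⟩
    have a2 : ∀ x ∈ C, (H.Adj r' (f x) ↔ x = u) := fun x hx =>
      ⟨fun hh => f4 x hx u huC (by rw [f1]; exact hno' _ (f2 x hx) hh), fun e => by
        rw [e, f1]; exact hru'⟩
    have b1 : ∀ x ∈ C, (G.Adj z x ↔ x = u) := fun x hx =>
      ⟨hnoz x hx, fun e => e ▸ hzu⟩
    have b2 : ∀ x ∈ C, (H.Adj z' (f x) ↔ x = u) := fun x hx =>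
      ⟨fun hh => f4 x hx u huC (by rw [f1]; exact hnoz' _ (f2 x hx) hh), fun e => by
        rw [e, f1]; exact hzu'⟩
    obtain ⟨g, hg⟩ : ∃ g, g = Function.update (Function.update f z z') r r' := ⟨_, rfl⟩
    have gr : g r = r' := by simp [hg]
    have gz : g z = z' := by simp [hg, hzr]
    have gC : ∀ x ∈ C, g x = f x := fun x hx => by
      rw [hg, Function.update_of_ne (hne x hx), Function.update_of_ne (hnez x hx)]
    refine ⟨g, gr, ?_, ?_, ?_, ?_⟩
    · intro x hx
      grind
    · intro y hy
      simp only [Finset.mem_insert] at hy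
      rcases hy with rfl | rfl | hy
      · exact ⟨r, by simp, gr⟩
      · exact ⟨z, by simp, gz⟩
      · obtain ⟨x, hx, hxy⟩ := f3 y hy
        exact ⟨x, by simp [hx], by rw [gC x hx]; exact hxy⟩
    · intro x hx y hy
      grind
    · intro x hx y hy
      simp only [Finset.mem_insert] at hx hy
      rcases hx with rfl | rfl | hx <;> rcases hy with rfl | rfl | hy
      · simp
      · rw [gr, gz]; exact ⟨fun _ => hrz, fun _ => hrz'⟩
      · rw [gr, gC y hy, a1 y hy, a2 y hy]
      · rw [gr, gz]; exact ⟨fun _ => hrz.symm, fun _ => hrz'.symm⟩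
      · simp
      · rw [gz, gC y hy, b1 y hy, b2 y hy]
      · rw [gr, gC x hx, G.adj_comm, H.adj_comm, a1 x hx, a2 x hx]
      · rw [gz, gC x hx, G.adj_comm, H.adj_comm, b1 x hx, b2 x hx]
      · rw [gC x hx, gC y hy]
        exact f5 x hx y hy

lemma Lin.iso {V W : Type*} [Fintype V] [Fintype W] {G : SimpleGraph V} {H : SimpleGraph W} {r : V}
    {r' : W} {w : List Bool} (h : Lin G r Finset.univ w) (h' : Lin H r' Finset.univ w) :
    Nonempty (G ≃g H) := by
  obtain ⟨f, -, -, f3, f4, f5⟩ := h.unique h'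
  refine ⟨⟨Equiv.ofBijective f ⟨fun x y e => f4 x (by simp) y (by simp) e, fun y => ?_⟩, ?_⟩⟩
  · obtain ⟨x, -, hx⟩ := f3 y (by simp)
    exact ⟨x, hx⟩
  · intro a b
    exact f5 a (by simp) b (by simp)

lemma Lin.transfer {V W : Type*} {G : SimpleGraph V} {H : SimpleGraph W} (e : G ≃g H) {r : V}
    {A : Finset V} {w : List Bool} (h : Lin G r A w) : Lin H (e r) (A.image e) w := by
  induction h with
  | nil r => simpa using Lin.nil (e r)
  | @bridge u r C w h hr hru hno ih =>
    rw [Finset.image_insert]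
    refine Lin.bridge ih ?_ (e.map_adj_iff.2 hru) ?_
    · simpa using hr
    · intro v hv hh
      obtain ⟨x, hx, rfl⟩ := Finset.mem_image.1 hv
      rw [hno x hx (e.map_adj_iff.1 hh)]
  | @tri u r z C w h hr hz hrz hru hzu hno hnoz ih =>
    rw [Finset.image_insert, Finset.image_insert]
    refine Lin.tri ih ?_ ?_ (e.map_adj_iff.2 hrz) (e.map_adj_iff.2 hru) (e.map_adj_iff.2 hzu) ?_ ?_
    · simpa using hr
    · simpa using hz
    · intro v hv hh
      obtain ⟨x, hx, rfl⟩ := Finset.mem_image.1 hv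
      rw [hno x hx (e.map_adj_iff.1 hh)]
    · intro v hv hh
      obtain ⟨x, hx, rfl⟩ := Finset.mem_image.1 hv
      rw [hnoz x hx (e.map_adj_iff.1 hh)]

end uniq

section exactness
variable {V : Type*} [Fintype V] {G : SimpleGraph V}

lemma sep_support {C : Finset V} {u : V} (hsep : ∀ x ∈ C, ∀ y, y ∉ C → G.Adj x y → x = u) {a b : V}
    (p : G.Walk a b) : a ∉ C → b ∈ C → u ∈ p.support := by
  induction p with
  | nil => intro h1 h2; exact absurd h2 h1
  | @cons a c b h p ih =>
    intro h1 h2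
    rw [SimpleGraph.Walk.support_cons, List.mem_cons]
    right
    by_cases hc : c ∈ C
    · rw [← hsep c hc a h1 h.symm]; exact p.start_mem_support
    · exact ih hc h2

lemma sep_dist (hG : G.Connected) {C : Finset V} {u : V}
    (hsep : ∀ x ∈ C, ∀ y, y ∉ C → G.Adj x y → x = u) {a b : V} (ha : a ∉ C) (hb : b ∈ C) :
    G.dist a u + G.dist u b ≤ G.dist a b := by
  obtain ⟨p, hp⟩ := hG.exists_walk_length_eq_dist a b
  have hu := sep_support hsep p ha hb
  have h1 := SimpleGraph.dist_le (p.takeUntil u hu)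
  have h2 := SimpleGraph.dist_le (p.dropUntil u hu)
  have h3 := congrArg SimpleGraph.Walk.length (p.take_spec hu)
  rw [SimpleGraph.Walk.length_append] at h3
  omega

lemma eA_mem_of {C : Finset V} {f : Sym2 V} (hf : f ∈ eA G C) {x : V} (hx : x ∈ f) : x ∈ C := by
  induction f with | _ a b =>
  rw [mem_eA] at hf
  rw [Sym2.mem_iff] at hx
  rcases hx with rfl | rfl
  · exact hf.2.1
  · exact hf.2.2

lemma sep_vDist (hG : G.Connected) {C : Finset V} {u : V}
    (hsep : ∀ x ∈ C, ∀ y, y ∉ C → G.Adj x y → x = u) {r : V} (hr : r ∉ C) (hru : G.Adj r u)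
    {f : Sym2 V} (hf : f ∈ eA G C) : vDist G r f = vDist G u f + 1 := by
  have hd1 : G.dist r u = 1 := SimpleGraph.dist_eq_one_iff_adj.2 hru
  apply le_antisymm
  · have := vDist_le_add hG r u f
    omega
  · obtain ⟨x, hx, e⟩ := vDist_mem G r f
    have h1 := sep_dist hG hsep hr (eA_mem_of hf hx)
    have h2 := vDist_le G (v := u) hx
    omega

lemma sep_sD (hG : G.Connected) {C : Finset V} {u : V}
    (hsep : ∀ x ∈ C, ∀ y, y ∉ C → G.Adj x y → x = u) {r : V} (hr : r ∉ C) (hru : G.Adj r u) :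
    sD G r (eA G C) = sD G u (eA G C) + nE G C := by
  unfold sD nE
  rw [Finset.card_eq_sum_ones, Nat.cast_sum, ← Finset.sum_add_distrib]
  refine Finset.sum_congr rfl fun f hf => ?_
  rw [sep_vDist hG hsep hr hru hf]; push_cast; ring

lemma hd_pair (a b : V) (f : Sym2 V) : hd G s(a, b) f = min (vDist G a f) (vDist G b f) := by
  apply le_antisymm
  · exact le_min (hd_le_of_mem G (by simp)) (hd_le_of_mem G (by simp))
  · obtain ⟨x, hx, y, hy, e⟩ := hd_mem G s(a, b) f
    rw [← e]
    rw [Sym2.mem_iff] at hx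
    rcases hx with rfl | rfl
    · exact (min_le_left _ _).trans (vDist_le G hy)
    · exact (min_le_right _ _).trans (vDist_le G hy)

lemma sep_sX_one (hG : G.Connected) {C : Finset V} {u : V}
    (hsep : ∀ x ∈ C, ∀ y, y ∉ C → G.Adj x y → x = u) {r : V} (hr : r ∉ C) (hru : G.Adj r u) :
    sX G {s(r, u)} (eA G C) = sD G u (eA G C) := by
  simp only [sX, sD, Finset.sum_singleton]
  refine Finset.sum_congr rfl fun f hf => ?_
  rw [hd_pair, sep_vDist hG hsep hr hru hf]; simp

lemma sep_sX_two (hG : G.Connected) {C : Finset V} {u : V}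
    (hsep : ∀ x ∈ C, ∀ y, y ∉ C → G.Adj x y → x = u) {r z : V} (hr : r ∉ C) (hru : G.Adj r u)
    (hz : z ∉ C) (hzu : G.Adj z u) :
    sX G {s(r, z)} (eA G C) = sD G u (eA G C) + nE G C := by
  rw [← sep_sD hG hsep hr hru]
  simp only [sX, sD, Finset.sum_singleton]
  refine Finset.sum_congr rfl fun f hf => ?_
  rw [hd_pair, sep_vDist hG hsep hr hru hf, sep_vDist hG hsep hz hzu hf]; simp

lemma Lin.exact_val (hG : G.Connected) {r : V} {A : Finset V} {w : List Bool} (h : Lin G r A w) :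
    (∀ x ∈ A, ∀ y, y ∉ A → G.Adj x y → x = r) → wsize w = nE G A ∧
    ∀ m : ℤ, sH G (eA G A) + 2 * (m - nE G A) * sD G r (eA G A) = 2 * wval m w := by
  induction h with
  | nil r =>
    intro _
    have e2 : nE G ({r} : Finset V) = 0 := by unfold nE; rw [eA_singleton]; simp
    refine ⟨by simp [wsize, e2], fun m => ?_⟩
    rw [eA_singleton, sH_empty, sD_empty]; simp [wval]
  | @bridge u r C w h hr hru hno ih =>
    intro hsepA
    have hsep : ∀ x ∈ C, ∀ y, y ∉ C → G.Adj x y → x = u := by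
      intro x hx y hy hxy
      by_cases hyr : y = r
      · subst hyr; exact hno x hx hxy.symm
      · exact absurd (hsepA x (by simp [hx]) y (by simp [hy, hyr]) hxy ▸ hx) hr
    obtain ⟨s, v⟩ := ih hsep
    have heq := eA_insert_one hr h.mem hru hno
    have hnot : s(r, u) ∉ eA G C := notMem_eA_left hr
    have hnE : nE G (insert r C) = nE G C + 1 := by
      unfold nE
      rw [heq, Finset.card_insert_of_notMem hnot]; push_cast; ring
    refine ⟨?_, fun m => ?_⟩
    · simp only [wsize, if_false, Bool.false_eq_true]; rw [s, hnE]; ring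
    · have hv : wval m (false :: w) = wval m w + nE G C * (m - 1 - nE G C) := by
        simp only [wval, if_false, Bool.false_eq_true]; rw [s]
      rw [hv, hnE, heq, sH_insert hnot, sD_insert hnot, vDist_of_mem G (by simp),
        sep_sX_one hG hsep hr hru, sep_sD hG hsep hr hru]
      have := v m
      push_cast
      linarith
  | @tri u r z C w h hr hz hrz hru hzu hno hnoz ih =>
    intro hsepA
    have hsep : ∀ x ∈ C, ∀ y, y ∉ C → G.Adj x y → x = u := by
      intro x hx y hy hxy
      by_cases hyr : y = r
      · subst hyr; exact hno x hx hxy.symm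
      · by_cases hyz : y = z
        · subst hyz; exact hnoz x hx hxy.symm
        · exact absurd (hsepA x (by simp [hx]) y (by simp [hy, hyr, hyz]) hxy ▸ hx) hr
    obtain ⟨s, v⟩ := ih hsep
    have heq1 := eA_insert_one hz h.mem hzu hnoz
    have hn1 : s(z, u) ∉ eA G C := notMem_eA_left hz
    have hr' : r ∉ insert z C := by simp [hr, hrz.ne]
    have heq2 := eA_insert_two (C := insert z C) (r := r) (u := u) (u' := z) hr' (by simp [h.mem]) hru
      (by simp) hrz (by
        intro v hv hrv
        rcases Finset.mem_insert.1 hv with h | h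
        · exact Or.inr h
        · exact Or.inl (hno v h hrv))
    have hn2 : s(r, z) ∉ insert s(z, u) (eA G C) := by
      rw [← heq1]; exact notMem_eA_left hr'
    have hn3 : s(r, u) ∉ insert s(r, z) (insert s(z, u) (eA G C)) := by
      rw [Finset.mem_insert, not_or, ← heq1]
      refine ⟨?_, notMem_eA_left hr'⟩
      rw [Sym2.eq_iff]
      have := hzu.ne
      have := hru.ne
      grind
    rw [heq1] at heq2
    have hnE : nE G (insert r (insert z C)) = nE G C + 3 := by
      unfold nE
      rw [heq2, Finset.card_insert_of_notMem hn3, Finset.card_insert_of_notMem hn2,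
        Finset.card_insert_of_notMem hn1]; push_cast; ring
    have e1 : hd G s(r, u) s(r, z) = 0 := by
      have := hd_le G (e := s(r, u)) (f := s(r, z)) (u := r) (w := r) (by simp) (by simp)
      simpa using this
    have e2 : hd G s(r, u) s(z, u) = 0 := by
      have := hd_le G (e := s(r, u)) (f := s(z, u)) (u := u) (w := u) (by simp) (by simp)
      simpa using this
    have e3 : hd G s(r, z) s(z, u) = 0 := by
      have := hd_le G (e := s(r, z)) (f := s(z, u)) (u := z) (w := z) (by simp) (by simp)
      simpa using this
    have e4 : vDist G r s(z, u) = 1 := by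
      obtain ⟨x, hx, e⟩ := vDist_mem G r s(z, u)
      rw [← e, SimpleGraph.dist_eq_one_iff_adj]
      rw [Sym2.mem_iff] at hx
      rcases hx with rfl | rfl
      · exact hrz
      · exact hru
    refine ⟨?_, fun m => ?_⟩
    · simp only [wsize, if_true]; rw [s, hnE]; ring
    · have hv : wval m (true :: w) = wval m w + (nE G C * (m - 3 - nE G C) + (m - 3)) := by
        simp only [wval, if_true]; rw [s]
      rw [hv, hnE, heq2, sH_insert hn3, sH_insert hn2, sH_insert hn1, sD_insert hn3, sD_insert hn2,
        sD_insert hn1, vDist_of_mem G (r := r) (e := s(r, u)) (by simp),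
        vDist_of_mem G (r := r) (e := s(r, z)) (by simp), e4, sX_insert_right hn2,
        sX_insert_right hn1, sX_insert_right hn1, e1, e2, e3,
        sep_sX_one hG hsep hr hru, sep_sX_one hG hsep hz hzu, sep_sX_two hG hsep hr hru hz hzu,
        sep_sD hG hsep hr hru]
      have := v m
      push_cast
      linarith

end exactness
set_option linter.unusedSimpArgs false
section saw

lemma Lin.bridge_of {V : Type*} {G : SimpleGraph V} {u r : V} {C A : Finset V} {w : List Bool}
    (hA : ∀ v, v ∈ A ↔ v = r ∨ v ∈ C) (h : Lin G u C w) (hr : r ∉ C)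
    (hru : G.Adj r u) (hno : ∀ v ∈ C, G.Adj r v → v = u) : Lin G r A (false :: w) := by
  have : A = insert r C := by ext v; rw [hA, Finset.mem_insert]
  rw [this]
  exact Lin.bridge h hr hru hno

lemma Lin.tri_of {V : Type*} {G : SimpleGraph V} {u r z : V} {C A : Finset V} {w : List Bool}
    (hA : ∀ v, v ∈ A ↔ v = r ∨ v = z ∨ v ∈ C) (h : Lin G u C w) (hr : r ∉ C) (hz : z ∉ C)
    (hrz : G.Adj r z) (hru : G.Adj r u) (hzu : G.Adj z u)
    (hno : ∀ v ∈ C, G.Adj r v → v = u) (hno' : ∀ v ∈ C, G.Adj z v → v = u) :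
    Lin G r A (true :: w) := by
  have : A = insert r (insert z C) := by ext v; rw [hA, Finset.mem_insert, Finset.mem_insert]
  rw [this]
  exact Lin.tri h hr hz hrz hru hzu hno hno'

lemma saw_ss {i j q : ℕ} (x y : Fin (i + q + j + 1)) :
    (sawGraph i j q).Adj (Sum.inl x) (Sum.inl y) ↔ (y : ℕ) = x + 1 ∨ (x : ℕ) = y + 1 := by
  rw [sawGraph, SimpleGraph.fromRel_adj]
  constructor
  · rintro ⟨-, (⟨a, b, h1, h2, h⟩ | ⟨a, b, h1, -⟩ | ⟨a, b, h1, -⟩) |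
      (⟨a, b, h1, h2, h⟩ | ⟨a, b, h1, -⟩ | ⟨a, b, h1, -⟩)⟩
    · cases h1; cases h2; exact Or.inl h
    · cases h1
    · cases h1
    · cases h1; cases h2; exact Or.inr h
    · cases h1
    · cases h1
  · have hne : (y : ℕ) ≠ x → (Sum.inl x : Fin (i + q + j + 1) ⊕ (Fin i ⊕ Fin j)) ≠ Sum.inl y := by
      intro h1 h2
      cases h2
      exact h1 rfl
    rintro (h | h)
    · exact ⟨hne (by omega), Or.inl (Or.inl ⟨x, y, rfl, rfl, h⟩)⟩
    · exact ⟨hne (by omega), Or.inr (Or.inl ⟨y, x, rfl, rfl, h⟩)⟩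

lemma saw_as {i j q : ℕ} (a : Fin i) (x : Fin (i + q + j + 1)) :
    (sawGraph i j q).Adj (Sum.inr (Sum.inl a)) (Sum.inl x) ↔ (x : ℕ) = a ∨ (x : ℕ) = a + 1 := by
  simp [sawGraph, SimpleGraph.fromRel_adj]

lemma saw_bs {i j q : ℕ} (a : Fin j) (x : Fin (i + q + j + 1)) :
    (sawGraph i j q).Adj (Sum.inr (Sum.inr a)) (Sum.inl x) ↔
      (x : ℕ) = i + q + a ∨ (x : ℕ) = i + q + a + 1 := by
  simp [sawGraph, SimpleGraph.fromRel_adj]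

lemma saw_rr {i j q : ℕ} (a b : Fin i ⊕ Fin j) :
    ¬ (sawGraph i j q).Adj (Sum.inr a) (Sum.inr b) := by
  simp [sawGraph, SimpleGraph.fromRel_adj]

/-- height of a vertex of the saw graph -/
def sawH (k q : ℕ) : Fin (k + q + k + 1) ⊕ (Fin k ⊕ Fin k) → ℕ
  | Sum.inl x => x
  | Sum.inr (Sum.inl a) => a + 1
  | Sum.inr (Sum.inr a) => k + q + a + 1

noncomputable def sawA (k q j : ℕ) : Finset (Fin (k + q + k + 1) ⊕ (Fin k ⊕ Fin k)) :=
  Finset.univ.filter (fun v => sawH k q v ≤ j)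

lemma mem_sawA_s {k q j : ℕ} (x : Fin (k + q + k + 1)) :
    (Sum.inl x : Fin (k + q + k + 1) ⊕ (Fin k ⊕ Fin k)) ∈ sawA k q j ↔ (x : ℕ) ≤ j := by
  unfold sawA; rw [Finset.mem_filter]; exact ⟨fun h => h.2, fun h => ⟨Finset.mem_univ _, h⟩⟩

lemma mem_sawA_a {k q j : ℕ} (a : Fin k) :
    (Sum.inr (Sum.inl a) : Fin (k + q + k + 1) ⊕ (Fin k ⊕ Fin k)) ∈ sawA k q j ↔
      (a : ℕ) + 1 ≤ j := by
  unfold sawA; rw [Finset.mem_filter]; exact ⟨fun h => h.2, fun h => ⟨Finset.mem_univ _, h⟩⟩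

lemma mem_sawA_b {k q j : ℕ} (a : Fin k) :
    (Sum.inr (Sum.inr a) : Fin (k + q + k + 1) ⊕ (Fin k ⊕ Fin k)) ∈ sawA k q j ↔
      k + q + (a : ℕ) + 1 ≤ j := by
  unfold sawA; rw [Finset.mem_filter]; exact ⟨fun h => h.2, fun h => ⟨Finset.mem_univ _, h⟩⟩

lemma saw_zero (k q : ℕ) :
    Lin (sawGraph k k q) (Sum.inl ⟨0, by omega⟩) (sawA k q 0) [] := by
  have : sawA k q 0 = {Sum.inl ⟨0, by omega⟩} := by
    ext v
    rcases v with x | a | a <;> simp only [Finset.mem_insert, Finset.mem_singleton, mem_sawA_s, mem_sawA_a, mem_sawA_b,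
      Sum.inl.injEq, Sum.inr.injEq, Fin.ext_iff, reduceCtorEq, false_or, or_false, iff_false] <;> omega
  rw [this]
  exact Lin.nil _

lemma saw_bridge (k q j : ℕ) (h1 : k ≤ j) (h2 : j < k + q) (w : List Bool)
    (h : Lin (sawGraph k k q) (Sum.inl ⟨j, by omega⟩) (sawA k q j) w) :
    Lin (sawGraph k k q) (Sum.inl ⟨j + 1, by omega⟩) (sawA k q (j + 1)) (false :: w) := by
  have hA : ∀ v, v ∈ sawA k q (j + 1) ↔ v = Sum.inl ⟨j + 1, by omega⟩ ∨ v ∈ sawA k q j := by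
    intro v
    rcases v with x | a | a <;> simp only [Finset.mem_insert, Finset.mem_singleton, mem_sawA_s, mem_sawA_a, mem_sawA_b,
      Sum.inl.injEq, Sum.inr.injEq, Fin.ext_iff, reduceCtorEq, false_or, or_false, iff_false] <;> omega
  refine Lin.bridge_of hA h ?_ ?_ ?_
  · rw [mem_sawA_s]; simp
  · rw [saw_ss]; simp
  intro v hv hadj
  rcases v with x | a | a
  · rw [saw_ss] at hadj
    first | rw [mem_sawA_s] at hv | rw [mem_sawA_a] at hv | rw [mem_sawA_b] at hv
    simp only [Sum.inl.injEq, Fin.ext_iff]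
    simp at hadj; omega
  · rw [SimpleGraph.adj_comm, saw_as] at hadj
    first | rw [mem_sawA_s] at hv | rw [mem_sawA_a] at hv | rw [mem_sawA_b] at hv
    simp at hadj; omega
  · rw [SimpleGraph.adj_comm, saw_bs] at hadj
    first | rw [mem_sawA_s] at hv | rw [mem_sawA_a] at hv | rw [mem_sawA_b] at hv
    simp at hadj; omega

lemma saw_tri1 (k q j : ℕ) (h1 : j < k) (w : List Bool)
    (h : Lin (sawGraph k k q) (Sum.inl ⟨j, by omega⟩) (sawA k q j) w) :
    Lin (sawGraph k k q) (Sum.inl ⟨j + 1, by omega⟩) (sawA k q (j + 1)) (true :: w) := by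
  have hA : ∀ v, v ∈ sawA k q (j + 1) ↔ v = Sum.inl ⟨j + 1, by omega⟩ ∨
      v = Sum.inr (Sum.inl ⟨j, h1⟩) ∨ v ∈ sawA k q j := by
    intro v
    rcases v with x | a | a <;> simp only [Finset.mem_insert, Finset.mem_singleton, mem_sawA_s, mem_sawA_a, mem_sawA_b,
      Sum.inl.injEq, Sum.inr.injEq, Fin.ext_iff, reduceCtorEq, false_or, or_false, iff_false] <;> omega
  refine Lin.tri_of hA h ?_ ?_ ?_ ?_ ?_ ?_ ?_
  · rw [mem_sawA_s]; simp
  · first | (rw [mem_sawA_a]; simp) | (rw [mem_sawA_b]; simp)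
  · rw [SimpleGraph.adj_comm, saw_as]; simp
  · rw [saw_ss]; simp
  · rw [saw_as]; simp
  all_goals
    intro v hv hadj
    rcases v with x | a | a
  · rw [saw_ss] at hadj
    first | rw [mem_sawA_s] at hv | rw [mem_sawA_a] at hv | rw [mem_sawA_b] at hv
    simp only [Sum.inl.injEq, Fin.ext_iff]
    simp at hadj; omega
  · rw [SimpleGraph.adj_comm, saw_as] at hadj
    first | rw [mem_sawA_s] at hv | rw [mem_sawA_a] at hv | rw [mem_sawA_b] at hv
    simp at hadj; omega
  · rw [SimpleGraph.adj_comm, saw_bs] at hadj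
    first | rw [mem_sawA_s] at hv | rw [mem_sawA_a] at hv | rw [mem_sawA_b] at hv
    simp at hadj; omega
  · rw [saw_as] at hadj
    first | rw [mem_sawA_s] at hv | rw [mem_sawA_a] at hv | rw [mem_sawA_b] at hv
    simp only [Sum.inl.injEq, Fin.ext_iff]
    simp at hadj; omega
  · exact absurd hadj (saw_rr _ _)
  · exact absurd hadj (saw_rr _ _)

lemma saw_tri2 (k q i : ℕ) (h1 : i < k) (w : List Bool)
    (h : Lin (sawGraph k k q) (Sum.inl ⟨k + q + i, by omega⟩) (sawA k q (k + q + i)) w) :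
    Lin (sawGraph k k q) (Sum.inl ⟨k + q + i + 1, by omega⟩) (sawA k q (k + q + i + 1))
      (true :: w) := by
  have hA : ∀ v, v ∈ sawA k q (k + q + i + 1) ↔ v = Sum.inl ⟨k + q + i + 1, by omega⟩ ∨
      v = Sum.inr (Sum.inr ⟨i, h1⟩) ∨ v ∈ sawA k q (k + q + i) := by
    intro v
    rcases v with x | a | a <;> simp only [Finset.mem_insert, Finset.mem_singleton, mem_sawA_s, mem_sawA_a, mem_sawA_b,
      Sum.inl.injEq, Sum.inr.injEq, Fin.ext_iff, reduceCtorEq, false_or, or_false, iff_false] <;> omega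
  refine Lin.tri_of hA h ?_ ?_ ?_ ?_ ?_ ?_ ?_
  · rw [mem_sawA_s]; simp
  · first | (rw [mem_sawA_a]; simp) | (rw [mem_sawA_b]; simp)
  · rw [SimpleGraph.adj_comm, saw_bs]; simp
  · rw [saw_ss]; simp
  · rw [saw_bs]; simp
  all_goals
    intro v hv hadj
    rcases v with x | a | a
  · rw [saw_ss] at hadj
    first | rw [mem_sawA_s] at hv | rw [mem_sawA_a] at hv | rw [mem_sawA_b] at hv
    simp only [Sum.inl.injEq, Fin.ext_iff]
    simp at hadj; omega
  · rw [SimpleGraph.adj_comm, saw_as] at hadj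
    first | rw [mem_sawA_s] at hv | rw [mem_sawA_a] at hv | rw [mem_sawA_b] at hv
    simp at hadj; omega
  · rw [SimpleGraph.adj_comm, saw_bs] at hadj
    first | rw [mem_sawA_s] at hv | rw [mem_sawA_a] at hv | rw [mem_sawA_b] at hv
    simp at hadj; omega
  · rw [saw_bs] at hadj
    first | rw [mem_sawA_s] at hv | rw [mem_sawA_a] at hv | rw [mem_sawA_b] at hv
    simp only [Sum.inl.injEq, Fin.ext_iff]
    simp at hadj; omega
  · exact absurd hadj (saw_rr _ _)
  · exact absurd hadj (saw_rr _ _)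

lemma saw_Lin (k q : ℕ) : ∃ r, Lin (sawGraph k k q) r Finset.univ (extW k q) := by
  have h1 : ∀ j (hj : j ≤ k), Lin (sawGraph k k q) (Sum.inl ⟨j, by omega⟩) (sawA k q j)
      (List.replicate j true) := by
    intro j
    induction j with
    | zero => intro _; exact saw_zero k q
    | succ j ih => intro hj; exact saw_tri1 k q j (by omega) _ (ih (by omega))
  have h2 : ∀ j (hj : j ≤ q), Lin (sawGraph k k q) (Sum.inl ⟨k + j, by omega⟩) (sawA k q (k + j))
      (List.replicate j false ++ List.replicate k true) := by
    intro j
    induction j with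
    | zero => intro _; exact h1 k le_rfl
    | succ j ih => intro hj; exact saw_bridge k q (k + j) (by omega) (by omega) _ (ih (by omega))
  have h3 : ∀ j (hj : j ≤ k), Lin (sawGraph k k q) (Sum.inl ⟨k + q + j, by omega⟩)
      (sawA k q (k + q + j))
      (List.replicate j true ++ (List.replicate q false ++ List.replicate k true)) := by
    intro j
    induction j with
    | zero => intro _; exact h2 q le_rfl
    | succ j ih => intro hj; exact saw_tri2 k q j (by omega) _ (ih (by omega))
  have h4 := h3 k le_rfl
  have e : sawA k q (k + q + k) = Finset.univ := by
    ext v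
    rcases v with x | a | a <;> simp only [mem_sawA_s, mem_sawA_a, mem_sawA_b, Finset.mem_univ, iff_true] <;> omega
  rw [e] at h4
  refine ⟨Sum.inl ⟨k + q + k, by omega⟩, ?_⟩
  unfold extW
  first
  | exact h4
  | (rw [List.append_assoc]; exact h4)

end saw

theorem stmt13 {V : Type*} [Fintype V] (n t k : ℕ) (hn5 : 5 ≤ n) (ht : t = 2 * k)
    (hn : 2 * t + 1 ≤ n)
    (G : SimpleGraph V) (hG : IsCactus G)
    (hcard : Fintype.card V = n) (hedges : G.edgeFinset.card = n - 1 + t) :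
    ((edgeWiener G : ℚ) ≤ (1 : ℚ) / 6 * n ^ 3 - 1 / 2 * n ^ 2 + 1 / 3 * n
        + k * n ^ 2 - 4 * k ^ 2 * n + 4 / 3 * k ^ 3 + 8 * k ^ 2 - 10 / 3 * k) ∧
      ((edgeWiener G : ℚ) = (1 : ℚ) / 6 * n ^ 3 - 1 / 2 * n ^ 2 + 1 / 3 * n
          + k * n ^ 2 - 4 * k ^ 2 * n + 4 / 3 * k ^ 3 + 8 * k ^ 2 - 10 / 3 * k ↔
        Nonempty (G ≃g sawGraph k k (n - 4 * k - 1))) := by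
  obtain ⟨q, hq⟩ : ∃ q, n = 4 * k + q + 1 := ⟨n - 4 * k - 1, by omega⟩
  have hq' : n - 4 * k - 1 = q := by omega
  rw [hq']
  have hm : G.edgeFinset.card = 6 * k + q := by omega
  have htop := top_bound hG k q (by omega) (by omega) hm
  have hS := sum_eDist (G := G) G.edgeFinset
  have hW : edgeWiener G = (∑ e ∈ G.edgeFinset, ∑ f ∈ G.edgeFinset, eDist G e f) / 2 := rfl
  generalize (∑ e ∈ G.edgeFinset, ∑ f ∈ G.edgeFinset, eDist G e f) = S at hS hW
  have hx := wval_extW k q n (by subst hq; push_cast; ring)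
  rw [hm] at hS
  push_cast at hS
  generalize hP : (n : ℤ) ^ 3 - 3 * n ^ 2 + 2 * n + 6 * k * n ^ 2 - 24 * k ^ 2 * n + 8 * k ^ 3
      + 48 * k ^ 2 - 20 * k = P at hx
  have hB : (1 : ℚ) / 6 * n ^ 3 - 1 / 2 * n ^ 2 + 1 / 3 * n
        + k * n ^ 2 - 4 * k ^ 2 * n + 4 / 3 * k ^ 3 + 8 * k ^ 2 - 10 / 3 * k = (P : ℚ) / 6 := by
    rw [← hP]; push_cast; ring
  rw [hB]
  have hle : (6 * (edgeWiener G : ℤ) : ℤ) ≤ 3 * S := by omega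
  have h3S : (3 * S : ℤ) ≤ P := by rw [hS]; nlinarith [htop.1]
  have hiff : ((edgeWiener G : ℚ) = (P : ℚ) / 6) ↔ 6 * (edgeWiener G : ℤ) = P := by
    rw [eq_div_iff (by norm_num), mul_comm]
    exact_mod_cast Iff.rfl
  refine ⟨?_, hiff.trans ⟨fun h => ?_, fun h => ?_⟩⟩
  · rw [le_div_iff₀ (by norm_num), mul_comm]
    exact_mod_cast hle.trans h3S
  · have h1 : (3 * S : ℤ) = P := by omega
    obtain ⟨r, hr⟩ := htop.2 (by rw [hS] at h1; linarith)
    obtain ⟨r', hr'⟩ := saw_Lin k q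
    exact Lin.iso hr (by convert hr')
  · obtain ⟨e⟩ := h
    obtain ⟨r', hr'⟩ := saw_Lin k q
    have h1 := Lin.transfer e.symm hr'
    have h2 : (Finset.univ.image e.symm : Finset V) = Finset.univ := by
      ext x; simp only [Finset.mem_image, Finset.mem_univ, true_and, iff_true]
      exact e.symm.surjective x
    have h3 : Lin G (e.symm r') Finset.univ (extW k q) := by
      rw [← h2]; convert h1
    obtain ⟨h4, h5⟩ := Lin.exact_val hG.1 h3 (fun x _ y hy => absurd (Finset.mem_univ y) hy)
    have h6 := h5 (6 * k + q)
    rw [wsize_extW] at h4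
    rw [← h4, eA_univ] at h6
    simp only [sub_self, mul_zero, zero_mul, add_zero] at h6
    have hev : Even ((6 * k + q : ℤ) * (6 * k + q - 1)) := Int.even_mul_pred_self _
    obtain ⟨c, hc⟩ := hev
    rw [h6, hc] at hS
    have h7 : 3 * (6 * k + q : ℤ) * (6 * k + q - 1) = 3 * (c + c) := by rw [← hc]; ring
    rw [h7] at hx
    omega
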